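/- Let W ⊂ ℝ^d be a two-dimensional linear subspace and let a₁,…,a_n ∈ ℝ^d be independent random vectors, each with an L-log-Lipschitz probability density. Let D be the event that ‖a_i − a_j‖₂ ≤ 3 for all i, j ∈ [n]. Then for every I ∈ ([n] choose d) and every J ∈ (I choose d−1): Pr[ dist( W ∩ affhull(a_i : i ∈ I), ∂conv(a_j : j ∈ J) ) ≤ 1/(19200 d⁴ L²) | E_I ∧ A_J ] ≤ 0.1 + Pr[¬D | E_I ∧ A_J]. -/

import Mathlib

open MeasureTheory Set
open scoped ENNReal ProbabilityTheory Pointwise RealInnerProductSpace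

noncomputable section

abbrev Euc (d : ℕ) := EuclideanSpace ℝ (Fin d)

/-- Number of edges (one-dimensional exposed faces) of a set. -/
def edgeCount {d : ℕ} (S : Set (Euc d)) : ℕ :=
  Set.ncard {F : Set (Euc d) | IsExposed ℝ S F ∧ Module.finrank ℝ (vectorSpan ℝ F) = 1}

/-- A probability density is `L`-log-Lipschitz. -/
def IsLogLipschitz {E : Type*} [NormedAddCommGroup E] (L : ℝ) (f : E → ℝ) : Prop :=
  (∀ x, 0 < f x) ∧ ∀ x y, f x ≤ Real.exp (L * ‖x - y‖) * f y

/-- Joint law of `n` independent points in `ℝ^d`, the `i`-th having density `f i`. -/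
def productDensityMeasure {n d : ℕ} (f : Fin n → Euc d → ℝ) :
    Measure (Fin n → Euc d) :=
  volume.withDensity fun ω => ENNReal.ofReal (∏ i, f i (ω i))

/-- `F` is a facet ((d-1)-dimensional exposed proper face) of `Q ⊆ ℝ^d`. -/
def IsFacet {d : ℕ} (Q F : Set (Euc d)) : Prop :=
  IsExposed ℝ Q F ∧ F ≠ Q ∧ Module.finrank ℝ (vectorSpan ℝ F) + 1 = d

/-- `R` is a ridge ((d-2)-dimensional exposed face) of `Q ⊆ ℝ^d`. -/
def IsRidge {d : ℕ} (Q R : Set (Euc d)) : Prop :=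
  IsExposed ℝ Q R ∧ Module.finrank ℝ (vectorSpan ℝ R) + 2 = d

/-- The edge event `E_I`: `conv(a_i : i ∈ I)` is a facet of `conv(a_1,…,a_n)` and it meets `W`. -/
def edgeEvent {n d : ℕ} (W : Submodule ℝ (Euc d)) (I : Finset (Fin n)) :
    Set (Fin n → Euc d) :=
  {ω | IsFacet (convexHull ℝ (Set.range ω)) (convexHull ℝ (ω '' ↑I)) ∧
    (convexHull ℝ (ω '' ↑I) ∩ ↑W).Nonempty}

/-- The vertex event `A_J`: `conv(a_j : j ∈ J)` is a ridge of `conv(a_1,…,a_n)` meeting `W`. -/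
def vertexEvent {n d : ℕ} (W : Submodule ℝ (Euc d)) (J : Finset (Fin n)) :
    Set (Fin n → Euc d) :=
  {ω | IsRidge (convexHull ℝ (Set.range ω)) (convexHull ℝ (ω '' ↑J)) ∧
    (convexHull ℝ (ω '' ↑J) ∩ ↑W).Nonempty}

/-- `y` is an outer unit normal, within the subspace `W`, of the face `e` of `S`:
`y ∈ W` is a unit vector whose inner product with points of `S` is maximized exactly
at the points of `e`. -/
def IsOuterNormal {d : ℕ} (W : Submodule ℝ (Euc d)) (S e : Set (Euc d)) (y : Euc d) : Prop :=
  y ∈ W ∧ ‖y‖ = 1 ∧ ∀ p ∈ e, ∀ q ∈ S, ⟪y, q⟫ ≤ ⟪y, p⟫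

/-- With respect to the orientation form `o` (an alternating bilinear form which is
non-degenerate on the plane of interest), the segment `[p₁, p₂]` is an edge of the planar
convex set `S` and `p₂` is its second endpoint in clockwise order: all of `S` lies on the
non-positive side of the oriented line through `p₁, p₂`.  Consequently, "the next vertex of
`S` after the edge `[p₁,p₂]` in clockwise order" is the point `p₃` with
`IsClockwiseEdge o S p₂ p₃`. -/
def IsClockwiseEdge {d : ℕ} (o : Euc d →ₗ[ℝ] Euc d →ₗ[ℝ] ℝ) (S : Set (Euc d))
    (p₁ p₂ : Euc d) : Prop :=
  p₁ ≠ p₂ ∧ IsExposed ℝ S (segment ℝ p₁ p₂) ∧ ∀ q ∈ S, o (p₂ - p₁) (q - p₁) ≤ 0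

theorem measurableSet_exists_of_isClosed {X Y : Type*} [TopologicalSpace X] [MeasurableSpace X]
    [OpensMeasurableSpace X] [TopologicalSpace Y] [SigmaCompactSpace Y] {C : X → Y → Prop}
    (hC : IsClosed {p : X × Y | C p.1 p.2}) : MeasurableSet {x | ∃ y, C x y} := by
  have : {x | ∃ y, C x y} = ⋃ m : ℕ, {x | ∃ y ∈ compactCovering Y m, C x y} := by
    ext x
    simp only [mem_ofPred_eq, mem_iUnion]
    constructor
    · rintro ⟨y, hy⟩
      obtain ⟨m, hm⟩ := mem_iUnion.1 ((iUnion_compactCovering Y).symm ▸ mem_univ y)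
      exact ⟨m, y, hm, hy⟩
    · rintro ⟨m, y, -, hy⟩
      exact ⟨y, hy⟩
  rw [this]
  refine MeasurableSet.iUnion fun m => IsClosed.measurableSet ?_
  have : CompactSpace (compactCovering Y m) :=
    isCompact_iff_compactSpace.1 (isCompact_compactCovering Y m)
  have h1 : IsClosed {p : X × compactCovering Y m | C p.1 p.2} :=
    hC.preimage (f := fun p : X × compactCovering Y m => (p.1, (p.2 : Y))) (by fun_prop)
  convert isClosedMap_fst_of_compactSpace _ h1 using 1
  ext x
  simp

theorem lintegral_prod_eq_abs_det_mul (a b c d : ℝ) (h : a * d - b * c ≠ 0)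
    {H : ℝ × ℝ → ℝ≥0∞} (hH : Measurable H) :
    ∫⁻ y, H y = ENNReal.ofReal |a * d - b * c| *
      ∫⁻ α : ℝ × ℝ, H (a * α.1 + b * α.2, c * α.1 + d * α.2) := by
  set A := Matrix.toLin (Module.Basis.finTwoProd ℝ) (Module.Basis.finTwoProd ℝ) !![a, b; c, d]
    with hA
  have hdet : LinearMap.det A = a * d - b * c := by
    rw [hA, LinearMap.det_toLin, Matrix.det_fin_two_of]
  have hd : LinearMap.det A ≠ 0 := by rwa [hdet]
  have key := Measure.map_linearMap_addHaar_eq_smul_addHaar (volume : Measure (ℝ × ℝ)) hd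
  have hAm : Measurable A := A.continuous_of_finiteDimensional.measurable
  have h2 : ∫⁻ α, H (A α) = ENNReal.ofReal |(LinearMap.det A)⁻¹| * ∫⁻ y, H y := by
    rw [← lintegral_map hH hAm, key, lintegral_smul_measure, smul_eq_mul]
  have h3 : ∀ α : ℝ × ℝ, A α = (a * α.1 + b * α.2, c * α.1 + d * α.2) := fun α => by
    rw [hA, Matrix.toLin_finTwoProd_apply]
  simp_rw [h3] at h2
  rw [h2, ← mul_assoc, ← ENNReal.ofReal_mul (abs_nonneg _), ← abs_mul, hdet, mul_inv_cancel₀ h]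
  simp

theorem lintegral_affine_scaling {V : Type*} [NormedAddCommGroup V] [NormedSpace ℝ V]
    [FiniteDimensional ℝ V] [MeasurableSpace V] [BorelSpace V] (μ : Measure V)
    [μ.IsAddHaarMeasure] (φ : V →ₗ[ℝ] ℝ) (c : ℝ) (e : V) (he : φ e = 1) {t : ℝ} (ht : 0 < t)
    {H : V → ℝ≥0∞} (hH : Measurable H) :
    ∫⁻ ξ, H (ξ + ((t - 1) * (φ ξ + c)) • e) ∂μ = ENNReal.ofReal t⁻¹ * ∫⁻ ξ, H ξ ∂μ := by
  set A := LinearMap.transvection ((t - 1) • φ) e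
  have hdet : LinearMap.det A = t := by
    rw [LinearMap.transvection.det]; simp [he]
  have hd : LinearMap.det A ≠ 0 := by rw [hdet]; exact ht.ne'
  have key := Measure.map_linearMap_addHaar_eq_smul_addHaar μ hd
  have hAm : Measurable A := A.continuous_of_finiteDimensional.measurable
  have h3 : ∀ ξ, ξ + ((t - 1) * (φ ξ + c)) • e = A ξ + ((t - 1) * c) • e := fun ξ => by
    simp only [A, LinearMap.transvection.apply, LinearMap.smul_apply, smul_eq_mul]
    rw [mul_add, add_smul, add_assoc]
  simp_rw [h3]
  rw [← lintegral_map (f := fun v => H (v + ((t - 1) * c) • e)) (by fun_prop) hAm, key,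
    lintegral_smul_measure, lintegral_add_right_eq_self, hdet, smul_eq_mul,
    abs_of_pos (inv_pos.2 ht)]

theorem ae_pairing_ne_zero {V : Type*} [NormedAddCommGroup V] [NormedSpace ℝ V]
    [FiniteDimensional ℝ V] [MeasurableSpace V] [BorelSpace V] (μ : Measure V)
    [μ.IsAddHaarMeasure] (q₁ q₂ : V →ₗ[ℝ] ℝ)
    (hq : ∀ a b : ℝ, a • q₁ + b • q₂ = 0 → a = 0 ∧ b = 0) :
    ∀ᵐ w ∂μ.prod μ, q₁ w.1 * q₂ w.2 - q₂ w.1 * q₁ w.2 ≠ 0 := by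
  have hc₁ := q₁.continuous_of_finiteDimensional
  have hc₂ := q₂.continuous_of_finiteDimensional
  have hker : ∀ φ : V →ₗ[ℝ] ℝ, φ ≠ 0 → ∀ᵐ ξ ∂μ, φ ξ ≠ 0 := fun φ hφ => by
    have := Measure.addHaar_submodule μ (LinearMap.ker φ)
      (fun h => hφ (LinearMap.ker_eq_top.1 h))
    rw [ae_iff]
    refine measure_mono_null (fun ξ hξ => ?_) this
    simpa using hξ
  have hm : MeasurableSet {w : V × V | q₁ w.1 * q₂ w.2 - q₂ w.1 * q₁ w.2 ≠ 0} := by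
    apply IsOpen.measurableSet
    apply isOpen_ne_fun <;> fun_prop
  refine (Measure.ae_prod_iff_ae_ae hm).2 ?_
  have h1 : q₁ ≠ 0 := fun h => one_ne_zero (hq 1 0 (by simp [h])).1
  filter_upwards [hker q₁ h1] with ξ hξ
  have h2 : q₁ ξ • q₂ - q₂ ξ • q₁ ≠ 0 := fun h => hξ (hq (-(q₂ ξ)) (q₁ ξ) (by
    rw [← h]; module)).2
  filter_upwards [hker _ h2] with η hη
  simpa using hη

theorem lintegral_prod_eq_lintegral_slope {V : Type*} [NormedAddCommGroup V] [NormedSpace ℝ V]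
    [FiniteDimensional ℝ V] [MeasurableSpace V] [BorelSpace V] (μ : Measure V)
    [μ.IsAddHaarMeasure] (q₁ q₂ : V →ₗ[ℝ] ℝ)
    (hq : ∀ a b : ℝ, a • q₁ + b • q₂ = 0 → a = 0 ∧ b = 0)
    {F : (V × ℝ) × (V × ℝ) → ℝ≥0∞} (hF : Measurable F) :
    ∫⁻ p, F p ∂((μ.prod volume).prod (μ.prod volume)) =
      ∫⁻ α : ℝ × ℝ, ∫⁻ w, ENNReal.ofReal |q₁ w.1 * q₂ w.2 - q₂ w.1 * q₁ w.2| *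
        F ((w.1, α.1 * q₁ w.1 + α.2 * q₂ w.1), (w.2, α.1 * q₁ w.2 + α.2 * q₂ w.2))
          ∂(μ.prod μ) := by
  have hc₁ := q₁.continuous_of_finiteDimensional.measurable
  have hc₂ := q₂.continuous_of_finiteDimensional.measurable
  have hcomp : ∀ {X : Type _} [MeasurableSpace X] {g : X → (V × ℝ) × (V × ℝ)},
      Measurable g → Measurable fun x => F (g x) := fun hg => hF.comp hg
  calc ∫⁻ p, F p ∂((μ.prod volume).prod (μ.prod volume))
      = ∫⁻ ξ, (∫⁻ y : ℝ, (∫⁻ η, (∫⁻ z : ℝ, F ((ξ, y), (η, z))) ∂μ)) ∂μ := by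
        rw [lintegral_prod _ hF.aemeasurable,
          lintegral_prod _ (Measurable.lintegral_prod_right' hF).aemeasurable]
        refine lintegral_congr fun ξ => lintegral_congr fun y => ?_
        rw [lintegral_prod _ (by fun_prop)]
    _ = ∫⁻ ξ, (∫⁻ η, (∫⁻ y : ℝ, (∫⁻ z : ℝ, F ((ξ, y), (η, z)))) ∂μ) ∂μ := by
        refine lintegral_congr fun ξ => ?_
        rw [lintegral_lintegral_swap]
        exact (Measurable.lintegral_prod_right'
          (f := fun p : (ℝ × V) × ℝ => F ((ξ, p.1.1), (p.1.2, p.2))) (by fun_prop)).aemeasurable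
    _ = ∫⁻ ξ, (∫⁻ η, (∫⁻ u : ℝ × ℝ, F ((ξ, u.1), (η, u.2))) ∂μ) ∂μ := by
        refine lintegral_congr fun ξ => lintegral_congr fun η => ?_
        rw [Measure.volume_eq_prod, lintegral_prod _ (by fun_prop)]
    _ = ∫⁻ w, (∫⁻ u : ℝ × ℝ, F ((w.1, u.1), (w.2, u.2))) ∂(μ.prod μ) := by
        rw [lintegral_prod (μ := μ) (ν := μ)]
        exact (Measurable.lintegral_prod_right'
          (f := fun p : (V × V) × (ℝ × ℝ) => F ((p.1.1, p.2.1), (p.1.2, p.2.2)))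
            (by fun_prop)).aemeasurable
    _ = ∫⁻ w, (∫⁻ α : ℝ × ℝ, ENNReal.ofReal |q₁ w.1 * q₂ w.2 - q₂ w.1 * q₁ w.2| *
        F ((w.1, α.1 * q₁ w.1 + α.2 * q₂ w.1), (w.2, α.1 * q₁ w.2 + α.2 * q₂ w.2)))
          ∂(μ.prod μ) := by
        refine lintegral_congr_ae ?_
        filter_upwards [ae_pairing_ne_zero μ q₁ q₂ hq] with w hw
        rw [lintegral_const_mul _ (by fun_prop),
          lintegral_prod_eq_abs_det_mul (q₁ w.1) (q₂ w.1) (q₁ w.2) (q₂ w.2) hw (by fun_prop)]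
        simp only [mul_comm]
    _ = _ := by
        rw [lintegral_lintegral_swap]
        fun_prop

theorem lintegral_le_of_slope_scaling {V : Type*} [NormedAddCommGroup V] [NormedSpace ℝ V]
    [FiniteDimensional ℝ V] [MeasurableSpace V] [BorelSpace V] (μ : Measure V)
    [μ.IsAddHaarMeasure] (q₁ q₂ : V →ₗ[ℝ] ℝ)
    (hq : ∀ a b : ℝ, a • q₁ + b • q₂ = 0 → a = 0 ∧ b = 0)
    {F G : (V × ℝ) × (V × ℝ) → ℝ≥0∞} (hF : Measurable F) (hG : Measurable G)
    {s : ℝ} (hs : 1 ≤ s) (K : ℝ≥0∞)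
    (h : ∀ᵐ α : ℝ × ℝ, ∃ φ : V →ₗ[ℝ] ℝ, ∃ c : ℝ, ∃ e : V, φ e = 1 ∧
      ∀ t : ℝ, 1 ≤ t → t ≤ 2 * s → ∀ ξ η ξ' η' : V,
        ξ' = ξ + ((t - 1) * (φ ξ + c)) • e → η' = η + ((t - 1) * (φ η + c)) • e →
        F ((ξ, α.1 * q₁ ξ + α.2 * q₂ ξ), (η, α.1 * q₁ η + α.2 * q₂ η)) ≤
        K * G ((ξ', α.1 * q₁ ξ' + α.2 * q₂ ξ'), (η', α.1 * q₁ η' + α.2 * q₂ η'))) :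
    ∫⁻ p, F p ∂((μ.prod volume).prod (μ.prod volume)) ≤
      ENNReal.ofReal (9 / 4 / s ^ 2) * K *
        ∫⁻ p, G p ∂((μ.prod volume).prod (μ.prod volume)) := by
  have hs0 : 0 < s := by linarith
  have hc₁ := q₁.continuous_of_finiteDimensional.measurable
  have hc₂ := q₂.continuous_of_finiteDimensional.measurable
  rw [lintegral_prod_eq_lintegral_slope μ q₁ q₂ hq hF,
    lintegral_prod_eq_lintegral_slope μ q₁ q₂ hq hG, ← lintegral_const_mul]
  swap
  · exact Measurable.lintegral_prod_right' (f := fun p : (ℝ × ℝ) × (V × V) =>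
      ENNReal.ofReal |q₁ p.2.1 * q₂ p.2.2 - q₂ p.2.1 * q₁ p.2.2| *
        G ((p.2.1, p.1.1 * q₁ p.2.1 + p.1.2 * q₂ p.2.1),
          (p.2.2, p.1.1 * q₁ p.2.2 + p.1.2 * q₂ p.2.2))) (by fun_prop)
  refine lintegral_mono_ae ?_
  filter_upwards [h] with α hα
  obtain ⟨φ, c, e, he, hα⟩ := hα
  have hφ := φ.continuous_of_finiteDimensional.measurable
  set T : ℝ → V → V := fun t ξ => ξ + ((t - 1) * (φ ξ + c)) • e with hT
  set D : V × V → ℝ := fun w => q₁ w.1 * q₂ w.2 - q₂ w.1 * q₁ w.2 with hD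
  set G' : V × V → ℝ≥0∞ := fun w => ENNReal.ofReal |D w| *
    G ((w.1, α.1 * q₁ w.1 + α.2 * q₂ w.1), (w.2, α.1 * q₁ w.2 + α.2 * q₂ w.2)) with hG'
  have hG'm : Measurable G' := by fun_prop
  have hTm : ∀ t, Measurable (T t) := fun t => by fun_prop
  have hscale : ∀ t : ℝ, 0 < t → ∫⁻ w, G' (T t w.1, T t w.2) ∂(μ.prod μ) =
      ENNReal.ofReal (t⁻¹ ^ 2) * ∫⁻ w, G' w ∂(μ.prod μ) := fun t ht => by
    have hTt := hTm t
    rw [lintegral_prod _ (by fun_prop), lintegral_prod _ hG'm.aemeasurable]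
    calc ∫⁻ ξ, ∫⁻ η, G' (T t ξ, T t η) ∂μ ∂μ
        = ∫⁻ ξ, ENNReal.ofReal t⁻¹ * ∫⁻ η, G' (T t ξ, η) ∂μ ∂μ := by
          refine lintegral_congr fun ξ => ?_
          exact lintegral_affine_scaling μ φ c e he ht (H := fun η => G' (T t ξ, η)) (by fun_prop)
      _ = ENNReal.ofReal t⁻¹ * (ENNReal.ofReal t⁻¹ * ∫⁻ ξ, ∫⁻ η, G' (ξ, η) ∂μ ∂μ) := by
          have hm : Measurable fun ξ => ∫⁻ η, G' (ξ, η) ∂μ :=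
            Measurable.lintegral_prod_right' hG'm
          rw [lintegral_const_mul _
            (show Measurable fun ξ => ∫⁻ η, G' (T t ξ, η) ∂μ from hm.comp hTt)]
          congr 1
          exact lintegral_affine_scaling μ φ c e he ht hm
      _ = _ := by
          rw [← mul_assoc, ← ENNReal.ofReal_mul (by positivity), sq]
  have hpt : ∀ w : V × V, ENNReal.ofReal |D w| *
      F ((w.1, α.1 * q₁ w.1 + α.2 * q₂ w.1), (w.2, α.1 * q₁ w.2 + α.2 * q₂ w.2)) ≤
      K * (2 * G' (T s w.1, T s w.2) + G' (T (2 * s) w.1, T (2 * s) w.2)) := fun w => by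
    have h1 := hα s hs (by linarith) w.1 w.2 (T s w.1) (T s w.2) rfl rfl
    have h2 := hα (2 * s) (by linarith) le_rfl w.1 w.2 (T (2 * s) w.1) (T (2 * s) w.2) rfl rfl
    have hdet : |D w| ≤ 2 * |D (T s w.1, T s w.2)| + |D (T (2 * s) w.1, T (2 * s) w.2)| := by
      have haff : ∀ t, D (T t w.1, T t w.2) = D w + (t - 1) *
          ((φ w.1 + c) * (q₁ e * q₂ w.2 - q₂ e * q₁ w.2) +
            (φ w.2 + c) * (q₁ w.1 * q₂ e - q₂ w.1 * q₁ e)) := fun t => by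
        simp only [hD, hT, map_add, map_smul, smul_eq_mul]
        ring
      rw [haff s, haff (2 * s)]
      generalize (φ w.1 + c) * (q₁ e * q₂ w.2 - q₂ e * q₁ w.2) +
            (φ w.2 + c) * (q₁ w.1 * q₂ e - q₂ w.1 * q₁ e) = B
      generalize D w = A
      have hid : s * A = (2 * s - 1) * (A + (s - 1) * B) - (s - 1) * (A + (2 * s - 1) * B) := by
        ring
      have : s * |A| ≤ s * (2 * |A + (s - 1) * B| + |A + (2 * s - 1) * B|) := by
        rw [← abs_of_pos hs0, ← abs_mul, abs_of_pos hs0, hid]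
        refine (abs_sub _ _).trans ?_
        rw [abs_mul, abs_mul, abs_of_nonneg (by linarith : 0 ≤ 2 * s - 1),
          abs_of_nonneg (by linarith : 0 ≤ s - 1)]
        nlinarith [abs_nonneg (A + (s - 1) * B), abs_nonneg (A + (2 * s - 1) * B)]
      exact le_of_mul_le_mul_left this hs0
    calc _ ≤ ENNReal.ofReal (2 * |D (T s w.1, T s w.2)| + |D (T (2 * s) w.1, T (2 * s) w.2)|) *
          F ((w.1, α.1 * q₁ w.1 + α.2 * q₂ w.1), (w.2, α.1 * q₁ w.2 + α.2 * q₂ w.2)) := by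
          gcongr
      _ = 2 * ENNReal.ofReal |D (T s w.1, T s w.2)| *
          F ((w.1, α.1 * q₁ w.1 + α.2 * q₂ w.1), (w.2, α.1 * q₁ w.2 + α.2 * q₂ w.2)) +
          ENNReal.ofReal |D (T (2 * s) w.1, T (2 * s) w.2)| *
          F ((w.1, α.1 * q₁ w.1 + α.2 * q₂ w.1), (w.2, α.1 * q₁ w.2 + α.2 * q₂ w.2)) := by
          rw [ENNReal.ofReal_add (by positivity) (by positivity), ENNReal.ofReal_mul (by norm_num),
            add_mul]
          simp
      _ ≤ _ := add_le_add (mul_le_mul_right h1 _) (mul_le_mul_right h2 _)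
      _ = _ := by
          simp only [hG']
          ring
  have hm1 : ∀ t, Measurable fun w : V × V => G' (T t w.1, T t w.2) := fun t => by
    have := hTm t
    fun_prop
  calc _ ≤ ∫⁻ w, K * (2 * G' (T s w.1, T s w.2) + G' (T (2 * s) w.1, T (2 * s) w.2))
        ∂(μ.prod μ) := lintegral_mono hpt
    _ = K * (2 * (ENNReal.ofReal (s⁻¹ ^ 2) * ∫⁻ w, G' w ∂(μ.prod μ)) +
        ENNReal.ofReal ((2 * s)⁻¹ ^ 2) * ∫⁻ w, G' w ∂(μ.prod μ)) := by
        have := hm1 s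
        have := hm1 (2 * s)
        rw [lintegral_const_mul _ (by fun_prop), lintegral_add_left (by fun_prop),
          lintegral_const_mul _ (by fun_prop), hscale s hs0, hscale (2 * s) (by linarith)]
    _ = _ := by
        have : ENNReal.ofReal (9 / 4 / s ^ 2) =
            2 * ENNReal.ofReal (s⁻¹ ^ 2) + ENNReal.ofReal ((2 * s)⁻¹ ^ 2) := by
          rw [show (2 : ℝ≥0∞) = ENNReal.ofReal 2 by simp, ← ENNReal.ofReal_mul (by norm_num),
            ← ENNReal.ofReal_add (by positivity) (by positivity)]
          congr 1
          field_simp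
          norm_num
        rw [this]
        ring

theorem exists_lintegral_eq_orthogonal_split {E : Type*} [NormedAddCommGroup E]
    [InnerProductSpace ℝ E] [FiniteDimensional ℝ E] [MeasurableSpace E] [BorelSpace E]
    (ν : Measure E) [ν.IsAddHaarMeasure] (a g : E) (hg : ‖g‖ = 1) :
    ∃ c : ℝ≥0∞, ∀ H : E → ℝ≥0∞, Measurable H →
      ∫⁻ p, H p ∂ν = c * ∫⁻ w : (ℝ ∙ g)ᗮ × ℝ, H (a + (w.1 + w.2 • g)) := by
  have hg0 : g ≠ 0 := fun h => by simp [h] at hg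
  have hgg : ⟪g, g⟫ = 1 := by rw [real_inner_self_eq_norm_sq, hg]; norm_num
  let A : ((ℝ ∙ g)ᗮ × ℝ) →ₗ[ℝ] E :=
    LinearMap.coprod (Submodule.subtype _) (LinearMap.toSpanSingleton ℝ E g)
  have hA : ∀ w, A w = w.1 + w.2 • g := fun w => by simp [A]
  have hinj : Function.Injective A := by
    rw [← LinearMap.ker_eq_bot, LinearMap.ker_eq_bot']
    rintro ⟨ξ, y⟩ h
    rw [hA] at h
    have h1 : y = 0 := by
      have := congrArg (fun v => ⟪g, v⟫) h
      simpa [inner_add_right, inner_smul_right, hg0,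
        Submodule.mem_orthogonal_singleton_iff_inner_right.1 ξ.2] using this
    subst h1
    simpa using h
  have hsurj : Function.Surjective A := fun v =>
    ⟨(⟨v - ⟪g, v⟫ • g, by
      rw [Submodule.mem_orthogonal_singleton_iff_inner_right, inner_sub_right, inner_smul_right,
        hgg]; ring⟩, ⟪g, v⟫), by rw [hA]; simp⟩
  let B := (LinearEquiv.ofBijective A ⟨hinj, hsurj⟩).toContinuousLinearEquiv
  have hB : ∀ w, B w = w.1 + w.2 • g := hA
  have hV : (volume : Measure ((ℝ ∙ g)ᗮ × ℝ)).IsAddHaarMeasure := by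
    rw [Measure.volume_eq_prod]
    infer_instance
  have hBH : (Measure.map B (volume : Measure ((ℝ ∙ g)ᗮ × ℝ))).IsAddHaarMeasure :=
    B.isAddHaarMeasure_map _
  refine ⟨Measure.addHaarScalarFactor ν (Measure.map B volume), fun H hH => ?_⟩
  conv_lhs => rw [Measure.isAddLeftInvariant_eq_smul ν (Measure.map B volume)]
  rw [← lintegral_add_left_eq_self _ a, lintegral_smul_measure, lintegral_map (by fun_prop)
    B.continuous.measurable]
  simp only [hB]
  rfl

theorem lintegral_pair_le_of_shear {E : Type*} [NormedAddCommGroup E]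
    [InnerProductSpace ℝ E] [FiniteDimensional ℝ E] [MeasurableSpace E] [BorelSpace E]
    (ν : Measure E) [ν.IsAddHaarMeasure] (a n : E) (hn : n ≠ 0) (U : Submodule ℝ E)
    (hU : Module.finrank ℝ U + 3 ≤ Module.finrank ℝ E)
    {F G : E × E → ℝ≥0∞} (hF : Measurable F) (hG : Measurable G)
    {s : ℝ} (hs : 1 ≤ s) (K : ℝ≥0∞)
    (h : ∀ ψ m : E, ψ ≠ 0 → ψ ∈ Uᗮ → m ≠ 0 → ⟪ψ, m⟫ = 0 → (∃ c : ℝ, n - m = c • ψ) →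
      ∀ t : ℝ, 1 ≤ t → t ≤ 2 * s → ∀ p q : E, ⟪ψ, p - a⟫ = 0 → ⟪ψ, q - a⟫ = 0 →
        F (p, q) ≤ K * G (p + ((t - 1) * ⟪n, p⟫) • (‖m‖ ^ 2)⁻¹ • m,
          q + ((t - 1) * ⟪n, q⟫) • (‖m‖ ^ 2)⁻¹ • m)) :
    ∫⁻ p, F p ∂(ν.prod ν) ≤ ENNReal.ofReal (9 / 4 / s ^ 2) * K * ∫⁻ p, G p ∂(ν.prod ν) := by
  have hdim : 3 ≤ Module.finrank ℝ Uᗮ := by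
    have := U.finrank_add_finrank_orthogonal
    omega
  let b := stdOrthonormalBasis ℝ Uᗮ
  have hon : Orthonormal ℝ fun i : Fin 3 => (b (Fin.castLE hdim i) : E) :=
    (b.orthonormal.comp _ (Fin.castLE_injective hdim)).comp_linearIsometry (Uᗮ).subtypeₗᵢ
  obtain ⟨g, hg, hgU⟩ : ∃ g : Fin 3 → E, Orthonormal ℝ g ∧ ∀ i, g i ∈ Uᗮ :=
    ⟨_, hon, fun i => (b _).2⟩
  have hg' : ∀ i j, ⟪g i, g j⟫ = if i = j then (1 : ℝ) else 0 := orthonormal_iff_ite.1 hg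
  obtain ⟨c, hc⟩ := exists_lintegral_eq_orthogonal_split ν a (g 0) (hg.1 0)
  set V := (ℝ ∙ (g 0))ᗮ with hV
  have hVmem : ∀ ξ : V, ⟪g 0, (ξ : E)⟫ = 0 := fun ξ =>
    Submodule.mem_orthogonal_singleton_iff_inner_right.1 ξ.2
  set P : V × ℝ → E := fun w => a + (w.1 + w.2 • g 0) with hP
  have hPm : Measurable P := by
    have : Continuous P := by fun_prop
    exact this.measurable
  have hdouble : ∀ H : E × E → ℝ≥0∞, Measurable H → ∫⁻ p, H p ∂(ν.prod ν) =
      c * (c * ∫⁻ w : (V × ℝ) × (V × ℝ), H (P w.1, P w.2)) := fun H hH => by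
    rw [lintegral_prod _ hH.aemeasurable, hc _ hH.lintegral_prod_right']
    congr 1
    have h1 : ∀ x, ∫⁻ y, H (x, y) ∂ν = c * ∫⁻ w, H (x, P w) := fun x =>
      hc (fun y => H (x, y)) (by fun_prop)
    simp_rw [h1]
    rw [lintegral_const_mul, Measure.volume_eq_prod (V × ℝ), lintegral_prod]
    · fun_prop
    · exact (Measurable.lintegral_prod_right'
        (f := fun p : (V × ℝ) × (V × ℝ) => H (P p.1, P p.2)) (by fun_prop))
  let q : Fin 3 → V →ₗ[ℝ] ℝ := fun i => (innerₛₗ ℝ (g i)).comp V.subtype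
  have hq : ∀ i (ξ : V), q i ξ = ⟪g i, (ξ : E)⟫ := fun i ξ => rfl
  have hgV : ∀ i, i ≠ 0 → g i ∈ V := fun i hi => by
    rw [hV, Submodule.mem_orthogonal_singleton_iff_inner_right, hg', if_neg hi.symm]
  have hindep : ∀ x y : ℝ, x • q 1 + y • q 2 = 0 → x = 0 ∧ y = 0 := fun x y hxy => by
    have h1 := LinearMap.congr_fun hxy ⟨g 1, hgV 1 (by decide)⟩
    have h2 := LinearMap.congr_fun hxy ⟨g 2, hgV 2 (by decide)⟩
    simp [hq, hg', hg.1] at h1 h2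
    exact ⟨h1, h2⟩
  have key := lintegral_le_of_slope_scaling (volume : Measure V) (q 1) (q 2) hindep
    (F := fun w => F (P w.1, P w.2)) (G := fun w => G (P w.1, P w.2)) (by fun_prop) (by fun_prop)
    hs K ?_
  · rw [hdouble F hF, hdouble G hG]
    refine (mul_le_mul_right (mul_le_mul_right key c) c).trans_eq ?_
    simp only [← Measure.volume_eq_prod]
    ring
  have hae : ∀ᵐ α : ℝ × ℝ, α ≠ (-⟪n, g 1⟫ / ⟪n, g 0⟫, -⟪n, g 2⟫ / ⟪n, g 0⟫) := by
    simp [ae_iff]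
  filter_upwards [hae] with α hα
  set ψ := g 0 - α.1 • g 1 - α.2 • g 2 with hψ
  have hψ0 : ⟪ψ, g 0⟫ = 1 := by simp [hψ, inner_sub_left, inner_smul_left, hg', hg.1]
  have hψ1 : ⟪ψ, g 1⟫ = -α.1 := by simp [hψ, inner_sub_left, inner_smul_left, hg', hg.1]
  have hψ2 : ⟪ψ, g 2⟫ = -α.2 := by simp [hψ, inner_sub_left, inner_smul_left, hg', hg.1]
  have hψne : ψ ≠ 0 := fun h0 => by simp [h0] at hψ0
  have hψψ : ⟪ψ, ψ⟫ ≠ 0 := inner_self_ne_zero.2 hψne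
  set m := n - (⟪ψ, n⟫ / ⟪ψ, ψ⟫) • ψ with hm
  have hψm : ⟪ψ, m⟫ = 0 := by
    rw [hm, inner_sub_right, inner_smul_right, div_mul_cancel₀ _ hψψ, sub_self]
  have hm0 : m ≠ 0 := fun h0 => by
    obtain ⟨k, hk⟩ : ∃ k : ℝ, n = k • ψ := ⟨_, sub_eq_zero.1 h0⟩
    have hk0 : k ≠ 0 := fun h => hn (by rw [hk, h, zero_smul])
    apply hα
    rw [hk]
    simp only [inner_smul_left, hψ0, hψ1, hψ2]
    ext <;> simp [hk0]
  set e := (‖m‖ ^ 2)⁻¹ • m with he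
  have hψe : ⟪ψ, e⟫ = 0 := by rw [he, inner_smul_right, hψm, mul_zero]
  have hne : ⟪n, e⟫ = 1 := by
    have : n = m + (⟪ψ, n⟫ / ⟪ψ, ψ⟫) • ψ := by rw [hm]; abel
    rw [this, inner_add_left, inner_smul_left, hψe, he, inner_smul_right,
      real_inner_self_eq_norm_sq]
    field_simp
    simp
  have heq : ⟪g 0, e⟫ = α.1 * ⟪g 1, e⟫ + α.2 * ⟪g 2, e⟫ := by
    have := hψe
    simp only [hψ, inner_sub_left, inner_smul_left] at this
    simp at this
    linarith
  let e' : V := ⟨e - ⟪g 0, e⟫ • g 0, by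
    rw [hV, Submodule.mem_orthogonal_singleton_iff_inner_right, inner_sub_right,
      inner_smul_right _ (g 0), hg', if_pos rfl]; ring⟩
  let B : V →ₗ[ℝ] E := V.subtype + (α.1 • q 1 + α.2 • q 2).smulRight (g 0)
  have hB : ∀ ξ, B ξ = ξ + (α.1 * q 1 ξ + α.2 * q 2 ξ) • g 0 := fun ξ => by simp [B]
  have hBe : B e' = e := by
    have h1 : q 1 e' = ⟪g 1, e⟫ := by simp [hq, e', inner_sub_right, inner_smul_right, hg']
    have h2 : q 2 e' = ⟪g 2, e⟫ := by simp [hq, e', inner_sub_right, inner_smul_right, hg']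
    rw [hB, h1, h2, ← heq]
    simp [e']
  refine ⟨(innerₛₗ ℝ n).comp B, ⟪n, a⟫, e', by simp [hBe, hne], fun t ht1 ht2 ξ η ξ' η' hξ hη => ?_⟩
  have hPB : ∀ ξ : V, P (ξ, α.1 * q 1 ξ + α.2 * q 2 ξ) = a + B ξ := fun ξ => by
    simp only [hP, hB]
  have hPψ : ∀ ξ : V, ⟪ψ, a + B ξ - a⟫ = 0 := fun ξ => by
    rw [add_sub_cancel_left, hB, inner_add_right, inner_smul_right, hψ0]
    simp only [hψ, inner_sub_left, inner_smul_left, hVmem, hq]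
    simp
  have hPT : ∀ ξ : V, a + B (ξ + ((t - 1) * (((innerₛₗ ℝ n).comp B) ξ + ⟪n, a⟫)) • e') =
      (a + B ξ) + ((t - 1) * ⟪n, a + B ξ⟫) • e := fun ξ => by
    simp only [map_add, map_smul, hBe, inner_add_right, LinearMap.comp_apply, innerₛₗ_apply_apply]
    rw [add_assoc, add_comm (inner ℝ n (B ξ))]
  subst hξ hη
  simp only [hPB, hPT]
  exact h ψ m hψne (Submodule.sub_mem _ (Submodule.sub_mem _ (hgU 0)
    (Submodule.smul_mem _ _ (hgU 1))) (Submodule.smul_mem _ _ (hgU 2))) hm0 hψm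
    ⟨⟪ψ, n⟫ / ⟪ψ, ψ⟫, by rw [hm]; abel⟩ t ht1 ht2 _ _ (hPψ ξ) (hPψ η)

/-- The points indexed by `I` lie on a hyperplane strictly supporting the remaining points, and some
convex combination of the points indexed by `J` lies in `W`. -/
def supportEvent {n d : ℕ} (W : Submodule ℝ (Euc d)) (I J : Finset (Fin n)) :
    Set (Fin n → Euc d) :=
  {ω | ∃ (c : Euc d) (h : ℝ) (w : Fin n → ℝ), (∀ i ∈ I, ⟪c, ω i⟫ = h) ∧ (∀ l ∉ I, ⟪c, ω l⟫ < h) ∧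
    (∀ i ∈ J, 0 ≤ w i) ∧ (∀ i ∉ J, w i = 0) ∧ ∑ i, w i = 1 ∧ ∑ i, w i • ω i ∈ W}

/-- The joint density of independent points. -/
def jointDensity {n d : ℕ} (f : Fin n → Euc d → ℝ) (ω : Fin n → Euc d) : ℝ≥0∞ :=
  ENNReal.ofReal (∏ i, f i (ω i))

theorem IsLogLipschitz.continuous {E : Type*} [NormedAddCommGroup E] {L : ℝ} {f : E → ℝ}
    (hf : IsLogLipschitz L f) : Continuous f := by
  have h : LipschitzWith (Real.toNNReal L) fun x => Real.log (f x) := by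
    refine LipschitzWith.of_le_add_mul _ fun x y => ?_
    have := Real.log_le_log (hf.1 x) (hf.2 x y)
    rw [Real.log_mul (Real.exp_pos _).ne' (hf.1 y).ne', Real.log_exp, ← dist_eq_norm] at this
    have h2 : L * dist x y ≤ Real.toNNReal L * dist x y :=
      mul_le_mul_of_nonneg_right (Real.le_coe_toNNReal L) dist_nonneg
    linarith
  have h2 : f = fun x => Real.exp (Real.log (f x)) := by
    ext x
    rw [Real.exp_log (hf.1 x)]
  rw [h2]
  exact Real.continuous_exp.comp h.continuous

theorem measurable_jointDensity {n d : ℕ} {L : ℝ} {f : Fin n → Euc d → ℝ}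
    (hf : ∀ i, IsLogLipschitz L (f i)) : Measurable (jointDensity f) := by
  have := fun i => (hf i).continuous
  have h : Continuous fun ω : Fin n → Euc d => ∏ i, f i (ω i) := by fun_prop
  exact ENNReal.measurable_ofReal.comp h.measurable

theorem jointDensity_le {n d : ℕ} {L : ℝ} (hL : 0 < L) {f : Fin n → Euc d → ℝ}
    (hf : ∀ i, IsLogLipschitz L (f i)) {ω ω' : Fin n → Euc d} {r : ℝ}
    (hr : ∑ i, ‖ω i - ω' i‖ ≤ r) :
    jointDensity f ω ≤ ENNReal.ofReal (Real.exp (L * r)) * jointDensity f ω' := by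
  unfold jointDensity
  rw [← ENNReal.ofReal_mul (Real.exp_pos _).le]
  refine ENNReal.ofReal_le_ofReal ?_
  calc ∏ i, f i (ω i) ≤ ∏ i, (Real.exp (L * ‖ω i - ω' i‖) * f i (ω' i)) :=
        Finset.prod_le_prod (fun i _ => ((hf i).1 _).le) fun i _ => (hf i).2 _ _
    _ = Real.exp (L * ∑ i, ‖ω i - ω' i‖) * ∏ i, f i (ω' i) := by
        rw [Finset.prod_mul_distrib, ← Real.exp_sum, Finset.mul_sum]
    _ ≤ _ := by
        have := Finset.prod_nonneg (s := Finset.univ) fun i _ => ((hf i).1 (ω' i)).le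
        gcongr

theorem productDensityMeasure_apply {n d : ℕ} (f : Fin n → Euc d → ℝ) {A : Set (Fin n → Euc d)}
    (hA : MeasurableSet A) :
    productDensityMeasure f A = ∫⁻ ω, A.indicator (jointDensity f) ω := by
  rw [lintegral_indicator hA, productDensityMeasure, withDensity_apply _ hA]
  rfl

/-- A quantitative degeneracy of the configuration with respect to the two points `i` and `j`. -/
def flatEvent {n d : ℕ} (W : Submodule ℝ (Euc d)) (I J : Finset (Fin n)) (i j : Fin n) (δ : ℝ) :
    Set (Fin n → Euc d) :=
  {ω | ∀ u m : Euc d, u ∈ Wᗮ → (∀ l ∈ J, l ≠ i → l ≠ j → ⟪u, ω l⟫ = 0) →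
    (∀ l ∈ I, ∀ l' ∈ I, ⟪u - m, ω l - ω l'⟫ = 0) → |⟪u, ω i⟫| + |⟪u, ω j⟫| ≤ δ * ‖m‖}

theorem exists_ne_zero_mem_orthogonal {d : ℕ} (W : Submodule ℝ (Euc d)) {ι : Type*}
    (s : Finset ι) (x : ι → Euc d) (h : Module.finrank ℝ W + s.card < d) :
    ∃ u : Euc d, u ≠ 0 ∧ u ∈ Wᗮ ∧ ∀ i ∈ s, ⟪u, x i⟫ = 0 := by
  classical
  set U := W ⊔ Submodule.span ℝ (s.image x : Set (Euc d))
  have h1 : Module.finrank ℝ U ≤ Module.finrank ℝ W + s.card :=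
    (Submodule.finrank_add_le_finrank_add_finrank _ _).trans
      (Nat.add_le_add_left ((finrank_span_finset_le_card _).trans Finset.card_image_le) _)
  have h2 : Uᗮ ≠ ⊥ := fun h0 => by
    have := U.finrank_add_finrank_orthogonal
    rw [h0, finrank_bot, finrank_euclideanSpace_fin] at this
    omega
  obtain ⟨u, hu, hu0⟩ := Submodule.exists_mem_ne_zero_of_ne_bot h2
  refine ⟨u, hu0, Submodule.orthogonal_le le_sup_left hu, fun i hi => ?_⟩
  rw [real_inner_comm]
  exact hu _ (Submodule.mem_sup_right (Submodule.subset_span (by simpa using ⟨i, hi, rfl⟩)))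

theorem lintegral_flatEvent_le {n d : ℕ} {L : ℝ} (hL : 0 < L)
    {W : Submodule ℝ (Euc d)} (hW : Module.finrank ℝ W = 2)
    {f : Fin n → Euc d → ℝ} (hf : ∀ i, IsLogLipschitz L (f i))
    {J : Finset (Fin n)} {k : Fin n} (hk : k ∉ J) (hJ : J.card + 1 = d)
    {i j : Fin n} (hi : i ∈ J) (hj : j ∈ J) (hij : i ≠ j) {s δ : ℝ} (hs : 1 ≤ s) (hδ : 0 < δ)
    (hS : MeasurableSet (supportEvent W (insert k J) J))
    {B : Set (Fin n → Euc d)} (hB : MeasurableSet B) (hBS : B ⊆ supportEvent W (insert k J) J)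
    (hBf : B ⊆ flatEvent W (insert k J) J i j δ)
    (hBg : ∀ ω ∈ B, ∀ c ψ : Euc d, ψ ≠ 0 → (∀ l ∈ J, ⟪c, ω l - ω k⟫ = 0) →
      (∀ l ∈ J, ⟪ψ, ω l - ω k⟫ = 0) → ∃ κ : ℝ, c = κ • ψ) :
    ∫⁻ ω, B.indicator (jointDensity f) ω ≤
      ENNReal.ofReal (9 / 4 / s ^ 2) * ENNReal.ofReal (Real.exp (L * (2 * s * δ))) *
      ∫⁻ ω, (supportEvent W (insert k J) J).indicator (jointDensity f) ω := by
  classical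
  set S := supportEvent W (insert k J) J with hSdef
  set C := ENNReal.ofReal (9 / 4 / s ^ 2) * ENNReal.ofReal (Real.exp (L * (2 * s * δ))) with hC
  have hdens := measurable_jointDensity hf
  have hFm : Measurable (B.indicator (jointDensity f)) := hdens.indicator hB
  have hGm : Measurable (S.indicator (jointDensity f)) := hdens.indicator hS
  rw [← lintegral_const_mul _ hGm]
  refine lintegral_le_of_lmarginal_le {i, j} hFm (hGm.const_mul _) fun x => ?_
  have hpair : ∀ H : (Fin n → Euc d) → ℝ≥0∞, Measurable H →
      (lmarginal (fun _ => volume) {i, j} H) x =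
        ∫⁻ p : Euc d × Euc d, H (Function.update (Function.update x i p.1) j p.2)
          ∂(volume.prod volume) := fun H hH => by
    have hm : Measurable fun p : Euc d × Euc d =>
        Function.update (Function.update x i p.1) j p.2 := by fun_prop
    rw [lmarginal_insert _ hH (by simpa using hij), lintegral_prod _
      (show AEMeasurable (fun p : Euc d × Euc d => H _) _ from (hH.comp hm).aemeasurable)]
    simp only [lmarginal_singleton]
  rw [hpair _ hFm, hpair _ (hGm.const_mul _), lintegral_const_mul _ (by fun_prop)]
  set R := (J.erase i).erase j with hR
  have hRmem : ∀ l, l ∈ R ↔ l ≠ j ∧ l ≠ i ∧ l ∈ J := fun l => by simp [hR]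
  have hRcard : R.card + 3 = d := by
    have hji : j ∈ J.erase i := Finset.mem_erase.2 ⟨hij.symm, hj⟩
    have := Finset.card_erase_add_one hji
    have := Finset.card_erase_add_one hi
    rw [hR]
    omega
  obtain ⟨u, hu0, huW, huR⟩ := exists_ne_zero_mem_orthogonal W R x (by omega)
  have hki : k ≠ i := fun h => hk (h ▸ hi)
  have hkj : k ≠ j := fun h => hk (h ▸ hj)
  set U := Submodule.span ℝ (R.image fun l => x l - x k : Set (Euc d)) with hU
  have hUdim : Module.finrank ℝ U + 3 ≤ Module.finrank ℝ (Euc d) := by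
    rw [finrank_euclideanSpace_fin]
    have : Module.finrank ℝ U ≤ R.card := (finrank_span_finset_le_card _).trans
      Finset.card_image_le
    omega
  refine lintegral_pair_le_of_shear volume (x k) u hu0 U hUdim
    (F := fun p => B.indicator (jointDensity f) (Function.update (Function.update x i p.1) j p.2))
    (G := fun p => S.indicator (jointDensity f) (Function.update (Function.update x i p.1) j p.2))
    (by fun_prop) (by fun_prop) hs _ ?_
  intro ψ m hψ0 hψU hm0 hψm hum t ht1 ht2 p q hp hq
  obtain ⟨c₁, hc₁⟩ := hum
  dsimp only
  set e := (‖m‖ ^ 2)⁻¹ • m with he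
  have hmpos : 0 < ‖m‖ := norm_pos_iff.2 hm0
  have hen : ‖e‖ = ‖m‖⁻¹ := by
    rw [he, norm_smul, norm_inv, norm_pow, norm_norm]
    field_simp
  set ω := Function.update (Function.update x i p) j q with hω
  set ω' := Function.update (Function.update x i (p + ((t - 1) * ⟪u, p⟫) • e)) j
    (q + ((t - 1) * ⟪u, q⟫) • e) with hω'
  by_cases hωB : ω ∈ B
  swap
  · rw [indicator_of_notMem hωB]; exact zero_le
  rw [indicator_of_mem hωB]
  have hωi : ω i = p := by simp [hω, hij]
  have hωj : ω j = q := by simp [hω]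
  have hωl : ∀ l, l ≠ i → l ≠ j → ω l = x l := fun l h1 h2 => by simp [hω, h1, h2]
  have hωR : ∀ l ∈ R, ω l = x l := fun l hl => hωl l ((hRmem l).1 hl).2.1 ((hRmem l).1 hl).1
  have hωk : ω k = x k := hωl k hki hkj
  have hψJ : ∀ l ∈ J, ⟪ψ, ω l - ω k⟫ = 0 := fun l hl => by
    rw [hωk]
    by_cases h1 : l = i
    · rw [h1, hωi, hp]
    by_cases h2 : l = j
    · rw [h2, hωj, hq]
    have hlR := (hRmem l).2 ⟨h2, h1, hl⟩
    rw [hωR l hlR, real_inner_comm]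
    refine hψU _ (Submodule.subset_span ?_)
    rw [Finset.coe_image]
    exact ⟨l, hlR, rfl⟩
  have hψI : ∀ l ∈ insert k J, ⟪ψ, ω l - ω k⟫ = 0 := fun l hl => by
    rcases Finset.mem_insert.1 hl with rfl | hl
    · simp
    · exact hψJ l hl
  have huR' : ∀ l ∈ J, l ≠ i → l ≠ j → ⟪u, ω l⟫ = 0 := fun l hl h1 h2 => by
    have hlR := (hRmem l).2 ⟨h2, h1, hl⟩
    rw [hωR l hlR, huR l hlR]
  have hflat : |⟪u, p⟫| + |⟪u, q⟫| ≤ δ * ‖m‖ := by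
    have := hBf hωB u m huW huR' fun l hl l' hl' => by
      have h3 : ω l - ω l' = (ω l - ω k) - (ω l' - ω k) := by abel
      rw [hc₁, inner_smul_left, h3, inner_sub_right, hψI l hl, hψI l' hl']
      simp
    rwa [hωi, hωj] at this
  have hω'l : ∀ l ∈ J, ω' l = ω l + ((t - 1) * ⟪u, ω l⟫) • e := fun l hl => by
    by_cases h2 : l = j
    · rw [h2, hωj]; simp [hω']
    by_cases h1 : l = i
    · rw [h1, hωi]; simp [hω', hij]
    rw [huR' l hl h1 h2]
    simp [hω', hω, h1, h2]
  have hω'n : ∀ l, l ≠ i → l ≠ j → ω' l = ω l := fun l h1 h2 => by simp [hω', hω, h1, h2]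
  have hω'S : ω' ∈ S := by
    obtain ⟨c, h, w, hcI, hcn, hw0, hwJ, hw1, hwW⟩ := hBS hωB
    have hck : ∀ l ∈ J, ⟪c, ω l - ω k⟫ = 0 := fun l hl => by
      rw [inner_sub_right, hcI l (Finset.mem_insert_of_mem hl),
        hcI k (Finset.mem_insert_self k J), sub_self]
    obtain ⟨κ, hκ⟩ := hBg ω hωB c ψ hψ0 hck hψJ
    have hce : ⟪c, e⟫ = 0 := by
      rw [hκ, he, inner_smul_left, inner_smul_right, hψm]; simp
    have hcω' : ∀ l, ⟪c, ω' l⟫ = ⟪c, ω l⟫ := fun l => by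
      by_cases hl : l ∈ J
      · rw [hω'l l hl, inner_add_right, inner_smul_right, hce]; simp
      · rw [hω'n l (fun h => hl (h ▸ hi)) (fun h => hl (h ▸ hj))]
    refine ⟨c, h, w, fun l hl => (hcω' l).trans (hcI l hl), fun l hl => (hcω' l).trans_lt (hcn l hl),
      hw0, hwJ, hw1, ?_⟩
    have hsum : ∑ l, w l • ω' l = ∑ l, w l • ω l + ((t - 1) * ⟪u, ∑ l, w l • ω l⟫) • e := by
      rw [inner_sum, Finset.mul_sum, Finset.sum_smul, ← Finset.sum_add_distrib]
      refine Finset.sum_congr rfl fun l _ => ?_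
      by_cases hl : l ∈ J
      · rw [hω'l l hl, inner_smul_right, smul_add, smul_smul]
        congr 2
        ring
      · simp [hwJ l hl]
    rw [hsum, real_inner_comm, huW _ hwW]
    simpa using hwW
  rw [indicator_of_mem hω'S]
  refine jointDensity_le hL hf ?_
  have hsub : ∑ l, ‖ω l - ω' l‖ = ∑ l ∈ {i, j}, ‖ω l - ω' l‖ := by
    refine (Finset.sum_subset (Finset.subset_univ _) fun l _ hl => ?_).symm
    simp only [Finset.mem_insert, Finset.mem_singleton, not_or] at hl
    rw [hω'n l hl.1 hl.2, sub_self, norm_zero]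
  have hnorm : ∀ l ∈ J, ‖ω l - ω' l‖ = (t - 1) * |⟪u, ω l⟫| * ‖m‖⁻¹ := fun l hl => by
    rw [hω'l l hl, sub_add_cancel_left, norm_neg, norm_smul, hen, Real.norm_eq_abs, abs_mul,
      abs_of_nonneg (by linarith : 0 ≤ t - 1)]
  rw [hsub, Finset.sum_pair hij, hnorm i hi, hnorm j hj, hωi, hωj]
  calc (t - 1) * |⟪u, p⟫| * ‖m‖⁻¹ + (t - 1) * |⟪u, q⟫| * ‖m‖⁻¹
      = (t - 1) * ((|⟪u, p⟫| + |⟪u, q⟫|) * ‖m‖⁻¹) := by ring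
    _ ≤ (t - 1) * (δ * ‖m‖ * ‖m‖⁻¹) := by
        have : 0 ≤ t - 1 := by linarith
        gcongr
    _ = (t - 1) * δ := by field_simp
    _ ≤ _ := by
        gcongr
        linarith

/-- The configurations in `supportEvent W I J` having a weight vector in `Z`. -/
def weightEvent {n d : ℕ} (W : Submodule ℝ (Euc d)) (I J : Finset (Fin n))
    (Z : Set (Fin n → ℝ)) : Set (Fin n → Euc d) :=
  {ω | ∃ (c : Euc d) (h : ℝ) (w : Fin n → ℝ), (∀ i ∈ I, ⟪c, ω i⟫ = h) ∧ (∀ l ∉ I, ⟪c, ω l⟫ < h) ∧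
    ((∀ i ∈ J, 0 ≤ w i) ∧ (∀ i ∉ J, w i = 0) ∧ ∑ i, w i = 1) ∧ ∑ i, w i • ω i ∈ W ∧ w ∈ Z}

theorem measurableSet_weightEvent {n d : ℕ} (W : Submodule ℝ (Euc d)) (I J : Finset (Fin n))
    {Z : Set (Fin n → ℝ)} (hZ : IsClosed Z) : MeasurableSet (weightEvent W I J Z) := by
  have hW : IsClosed (W : Set (Euc d)) := W.closed_of_finiteDimensional
  have : weightEvent W I J Z = {ω | ∃ y : Euc d × ℝ × (Fin n → ℝ) × ℝ,
      (∀ i ∈ I, ⟪y.1, ω i⟫ = y.2.1) ∧ (∀ l ∉ I, 1 ≤ y.2.2.2 * (y.2.1 - ⟪y.1, ω l⟫)) ∧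
      0 ≤ y.2.2.2 ∧ (∀ i ∈ J, 0 ≤ y.2.2.1 i) ∧ (∀ i ∉ J, y.2.2.1 i = 0) ∧
      ∑ i, y.2.2.1 i = 1 ∧ ∑ i, y.2.2.1 i • ω i ∈ W ∧ y.2.2.1 ∈ Z} := by
    ext ω
    constructor
    · rintro ⟨c, h, w, h1, h2, ⟨h3, h4, h5⟩, h6, h7⟩
      have hpos : ∀ l ∈ Iᶜ, 0 ≤ (h - ⟪c, ω l⟫)⁻¹ := fun l hl =>
        inv_nonneg.2 (sub_nonneg.2 (h2 l (Finset.mem_compl.1 hl)).le)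
      refine ⟨(c, h, w, ∑ l ∈ Iᶜ, (h - ⟪c, ω l⟫)⁻¹), h1, fun l hl => ?_, ?_, h3, h4, h5, h6, h7⟩
      · have h0 : 0 < h - ⟪c, ω l⟫ := sub_pos.2 (h2 l hl)
        have := Finset.single_le_sum hpos (Finset.mem_compl.2 hl)
        calc 1 = (h - ⟪c, ω l⟫)⁻¹ * (h - ⟪c, ω l⟫) := (inv_mul_cancel₀ h0.ne').symm
          _ ≤ _ := by dsimp only; gcongr
      · exact Finset.sum_nonneg hpos
    · rintro ⟨⟨c, h, w, t⟩, h1, h2, h0, h3, h4, h5, h6, h7⟩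
      refine ⟨c, h, w, h1, fun l hl => ?_, ⟨h3, h4, h5⟩, h6, h7⟩
      by_contra hcon
      have := h2 l hl
      dsimp only at this h0
      nlinarith
  rw [this]
  refine measurableSet_exists_of_isClosed ?_
  simp only [Set.ofPred_and, Set.ofPred_forall]
  refine .inter ?_ (.inter ?_ (.inter ?_ (.inter ?_ (.inter ?_ (.inter ?_ (.inter ?_ ?_))))))
  · exact isClosed_iInter fun i => isClosed_iInter fun _ => isClosed_eq (by fun_prop) (by fun_prop)
  · exact isClosed_iInter fun i => isClosed_iInter fun _ => isClosed_le (by fun_prop) (by fun_prop)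
  · exact isClosed_le (by fun_prop) (by fun_prop)
  · exact isClosed_iInter fun i => isClosed_iInter fun _ => isClosed_le (by fun_prop) (by fun_prop)
  · exact isClosed_iInter fun i => isClosed_iInter fun _ => isClosed_eq (by fun_prop) (by fun_prop)
  · exact isClosed_eq (by fun_prop) (by fun_prop)
  · exact hW.preimage (f := fun p : (Fin n → Euc d) × Euc d × ℝ × (Fin n → ℝ) × ℝ =>
      ∑ i, p.2.2.2.1 i • p.1 i) (by fun_prop)
  · exact hZ.preimage (f := fun p : (Fin n → Euc d) × Euc d × ℝ × (Fin n → ℝ) × ℝ => p.2.2.2.1)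
      (by fun_prop)

theorem measurableSet_supportEvent {n d : ℕ} (W : Submodule ℝ (Euc d)) (I J : Finset (Fin n)) :
    MeasurableSet (supportEvent W I J) := by
  convert measurableSet_weightEvent W I J isClosed_univ using 1
  simp [supportEvent, weightEvent, and_assoc]

theorem measurableSet_flatEvent {n d : ℕ} (W : Submodule ℝ (Euc d)) (I J : Finset (Fin n))
    (i j : Fin n) (δ : ℝ) : MeasurableSet (flatEvent W I J i j δ) := by
  have hW : IsClosed (Wᗮ : Set (Euc d)) := Wᗮ.closed_of_finiteDimensional
  rw [← MeasurableSet.compl_iff]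
  have : (flatEvent W I J i j δ)ᶜ = {ω | ∃ y : Euc d × Euc d × ℝ, y.1 ∈ Wᗮ ∧
      (∀ l ∈ J, l ≠ i → l ≠ j → ⟪y.1, ω l⟫ = 0) ∧
      (∀ l ∈ I, ∀ l' ∈ I, ⟪y.1 - y.2.1, ω l - ω l'⟫ = 0) ∧ 0 ≤ y.2.2 ∧
      1 ≤ y.2.2 * (|⟪y.1, ω i⟫| + |⟪y.1, ω j⟫| - δ * ‖y.2.1‖)} := by
    ext ω
    simp only [flatEvent, mem_compl_iff, mem_ofPred_eq, not_forall, not_le]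
    constructor
    · rintro ⟨u, m, h1, h2, h3, h4⟩
      have h0 := sub_pos.2 h4
      exact ⟨(u, m, (|⟪u, ω i⟫| + |⟪u, ω j⟫| - δ * ‖m‖)⁻¹), h1, h2, h3, inv_nonneg.2 h0.le,
        (inv_mul_cancel₀ h0.ne').ge⟩
    · rintro ⟨⟨u, m, t⟩, h1, h2, h3, h0, h4⟩
      refine ⟨u, m, h1, h2, h3, ?_⟩
      by_contra hcon
      dsimp only at h0 h4
      nlinarith
  rw [this]
  refine measurableSet_exists_of_isClosed ?_
  simp only [Set.ofPred_and, Set.ofPred_forall]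
  refine .inter ?_ (.inter ?_ (.inter ?_ (.inter ?_ ?_)))
  · exact hW.preimage (f := fun p : (Fin n → Euc d) × Euc d × Euc d × ℝ => p.2.1) (by fun_prop)
  · exact isClosed_iInter fun l => isClosed_iInter fun _ => isClosed_iInter fun _ =>
      isClosed_iInter fun _ => isClosed_eq (by fun_prop) (by fun_prop)
  · exact isClosed_iInter fun l => isClosed_iInter fun _ => isClosed_iInter fun _ =>
      isClosed_iInter fun _ => isClosed_eq (by fun_prop) (by fun_prop)
  · exact isClosed_le (by fun_prop) (by fun_prop)
  · exact isClosed_le (by fun_prop) (by fun_prop)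

theorem volume_eq_zero_of_update {n d : ℕ} {A : Set (Fin n → Euc d)} (hA : MeasurableSet A)
    (k : Fin n) (h : ∀ x : Fin n → Euc d, volume {p | Function.update x k p ∈ A} = 0) :
    volume A = 0 := by
  have := lintegral_le_of_lmarginal_le (μ := fun _ : Fin n => (volume : Measure (Euc d))) {k}
    (f := A.indicator 1) (g := 0) (measurable_one.indicator hA) measurable_zero fun x => by
      rw [lmarginal_singleton]
      dsimp only
      have h2 : (fun p => A.indicator (1 : (Fin n → Euc d) → ℝ≥0∞) (Function.update x k p)) =
          {p | Function.update x k p ∈ A}.indicator 1 := by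
        ext p
        simp only [indicator, mem_ofPred_eq, Pi.one_apply]
      rw [h2, lintegral_indicator_one₀, h x]
      · exact zero_le
      · exact (hA.preimage (by fun_prop : Measurable (Function.update x k))).nullMeasurableSet
  rw [← volume_pi, lintegral_indicator_one hA] at this
  simpa using this

theorem ae_not_mem_add_span {n d : ℕ} (U : Submodule ℝ (Euc d)) (K : Finset (Fin n)) {k : Fin n}
    (hk : k ∉ K) (h : K.card + Module.finrank ℝ U < d) :
    ∀ᵐ ω : Fin n → Euc d, ∀ τ : Fin n → ℝ, ω k - ∑ i ∈ K, τ i • ω i ∉ U := by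
  classical
  have hU : IsClosed (U : Set (Euc d)) := U.closed_of_finiteDimensional
  rw [ae_iff]
  simp only [not_forall, not_not]
  refine volume_eq_zero_of_update (measurableSet_exists_of_isClosed ?_) k fun x => ?_
  · exact hU.preimage (f := fun p : (Fin n → Euc d) × (Fin n → ℝ) =>
      p.1 k - ∑ i ∈ K, p.2 i • p.1 i) (by fun_prop)
  · set V := U ⊔ Submodule.span ℝ (K.image x : Set (Euc d)) with hV
    have hdim : Module.finrank ℝ V ≤ Module.finrank ℝ U + K.card :=
      (Submodule.finrank_add_le_finrank_add_finrank _ _).trans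
        (Nat.add_le_add_left ((finrank_span_finset_le_card _).trans Finset.card_image_le) _)
    have hVtop : V ≠ ⊤ := fun h0 => by
      rw [h0, finrank_top, finrank_euclideanSpace_fin] at hdim
      omega
    refine measure_mono_null ?_ (Measure.addHaar_submodule volume V hVtop)
    rintro p ⟨τ, hτ⟩
    have hsum : ∑ i ∈ K, τ i • Function.update x k p i = ∑ i ∈ K, τ i • x i :=
      Finset.sum_congr rfl fun i hi => by
        rw [Function.update_of_ne (ne_of_mem_of_not_mem hi hk)]
    rw [hsum, Function.update_self] at hτ
    have : p = (p - ∑ i ∈ K, τ i • x i) + ∑ i ∈ K, τ i • x i := by abel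
    rw [SetLike.mem_coe, this]
    refine V.add_mem (Submodule.mem_sup_left hτ) (Submodule.mem_sup_right ?_)
    exact Submodule.sum_mem _ fun i hi => Submodule.smul_mem _ _
      (Submodule.subset_span (by simpa using ⟨i, hi, rfl⟩))

theorem ae_forall_sum_mem_imp {n d : ℕ} (U : Submodule ℝ (Euc d)) (K : Finset (Fin n))
    (h : K.card + Module.finrank ℝ U ≤ d) :
    ∀ᵐ ω : Fin n → Euc d, ∀ τ : Fin n → ℝ, ∑ i ∈ K, τ i • ω i ∈ U → ∀ i ∈ K, τ i = 0 := by
  classical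
  induction K using Finset.induction_on with
  | empty => simp
  | insert k K hk ih =>
    rw [Finset.card_insert_of_notMem hk] at h
    filter_upwards [ih (by omega), ae_not_mem_add_span U K hk (by omega)] with ω h1 h2 τ hτ
    rw [Finset.sum_insert hk] at hτ
    have hk0 : τ k = 0 := by
      by_contra hne
      apply h2 fun i => -((τ k)⁻¹ * τ i)
      have := U.smul_mem (τ k)⁻¹ hτ
      rw [smul_add, smul_smul, inv_mul_cancel₀ hne, one_smul, Finset.smul_sum] at this
      simpa [smul_smul, neg_smul, Finset.sum_neg_distrib, sub_neg_eq_add] using this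
    rw [hk0, zero_smul, zero_add] at hτ
    intro i hi
    rcases Finset.mem_insert.1 hi with rfl | hi
    · exact hk0
    · exact h1 τ hτ i hi

theorem ae_ne_affine_combination {n d : ℕ} {I : Finset (Fin n)} (hI : I.card = d) (hd : 0 < d)
    {l : Fin n} (hl : l ∉ I) :
    ∀ᵐ ω : Fin n → Euc d, ∀ τ : Fin n → ℝ, ∑ i ∈ I, τ i = 1 → ω l ≠ ∑ i ∈ I, τ i • ω i := by
  classical
  rw [ae_iff]
  simp only [not_forall, not_not]
  simp only [exists_prop]
  refine volume_eq_zero_of_update (measurableSet_exists_of_isClosed ?_) l fun x => ?_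
  · exact (isClosed_eq (by fun_prop) (by fun_prop)).inter
      (isClosed_eq (f := fun p : (Fin n → Euc d) × (Fin n → ℝ) => p.1 l)
        (by fun_prop) (by fun_prop))
  · set A := affineSpan ℝ (I.image x : Set (Euc d)) with hA
    have hAtop : A ≠ ⊤ := fun h0 => by
      have h1 := finrank_vectorSpan_image_finset_le ℝ x I (n := d - 1) (by omega)
      rw [← direction_affineSpan, ← hA, h0, AffineSubspace.direction_top, finrank_top,
        finrank_euclideanSpace_fin] at h1
      omega
    refine measure_mono_null ?_ (Measure.addHaar_affineSubspace volume A hAtop)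
    rintro p ⟨τ, hτ1, hτ⟩
    have hsum : ∑ i ∈ I, τ i • Function.update x l p i = ∑ i ∈ I, τ i • x i :=
      Finset.sum_congr rfl fun i hi => by
        rw [Function.update_of_ne (ne_of_mem_of_not_mem hi hl)]
    rw [hsum, Function.update_self] at hτ
    rw [hτ, ← Finset.affineCombination_eq_linear_combination I x τ hτ1, hA, Finset.coe_image]
    exact affineCombination_mem_affineSpan_image hτ1 (fun i hi hi' => (hi' hi).elim) x

/-- General position of a configuration with respect to `W`, `I` and `J`. -/
structure IsGeneric {n d : ℕ} (W : Submodule ℝ (Euc d)) (I J : Finset (Fin n))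
    (ω : Fin n → Euc d) : Prop where
  linear : ∀ τ : Fin n → ℝ, ∑ i ∈ I, τ i • ω i = 0 → ∀ i ∈ I, τ i = 0
  mem : ∀ j ∈ J, ∀ τ : Fin n → ℝ, ∑ i ∈ J.erase j, τ i • ω i ∈ W → ∀ i ∈ J.erase j, τ i = 0
  affine : ∀ l ∉ I, ∀ τ : Fin n → ℝ, ∑ i ∈ I, τ i = 1 → ω l ≠ ∑ i ∈ I, τ i • ω i

theorem ae_isGeneric {n d : ℕ} {W : Submodule ℝ (Euc d)} (hW : Module.finrank ℝ W = 2)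
    {I J : Finset (Fin n)} (hI : I.card = d) (hJ : J.card + 1 = d) :
    ∀ᵐ ω : Fin n → Euc d, IsGeneric W I J ω := by
  have h1 := ae_forall_sum_mem_imp (⊥ : Submodule ℝ (Euc d)) I (by simp [hI])
  have h2 : ∀ᵐ ω : Fin n → Euc d, ∀ j ∈ J, ∀ τ : Fin n → ℝ,
      ∑ i ∈ J.erase j, τ i • ω i ∈ W → ∀ i ∈ J.erase j, τ i = 0 := by
    rw [ae_all_iff]
    intro j
    by_cases hj : j ∈ J
    · have := Finset.card_erase_add_one hj
      filter_upwards [ae_forall_sum_mem_imp W (J.erase j) (by omega)] with ω h _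
      exact h
    · simp [hj]
  have h3 : ∀ᵐ ω : Fin n → Euc d, ∀ l ∉ I, ∀ τ : Fin n → ℝ, ∑ i ∈ I, τ i = 1 →
      ω l ≠ ∑ i ∈ I, τ i • ω i := by
    rw [ae_all_iff]
    intro l
    by_cases hl : l ∈ I
    · simp [hl]
    · filter_upwards [ae_ne_affine_combination hI (by omega) hl] with ω h _
      exact h
  filter_upwards [h1, h2, h3] with ω h1 h2 h3
  exact ⟨fun τ h => h1 τ (by simpa using h), h2, h3⟩

theorem IsGeneric.affineIndependent {n d : ℕ} {W : Submodule ℝ (Euc d)} {I J : Finset (Fin n)}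
    {ω : Fin n → Euc d} (hω : IsGeneric W I J ω) :
    AffineIndependent ℝ (fun i : I => ω i) := by
  have h : LinearIndependent ℝ (fun i : I => ω i) := linearIndepOn_finset_iff.2 hω.linear
  exact h.affineIndependent

theorem IsGeneric.weight_ne_zero {n d : ℕ} {W : Submodule ℝ (Euc d)} {I J : Finset (Fin n)}
    {ω : Fin n → Euc d} (hω : IsGeneric W I J ω) {w : Fin n → ℝ} (hwJ : ∀ i ∉ J, w i = 0)
    (hw1 : ∑ i, w i = 1) (hwW : ∑ i, w i • ω i ∈ W) {j : Fin n} (hj : j ∈ J) : w j ≠ 0 := by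
  intro h0
  have hz : ∀ i ∉ J.erase j, w i = 0 := fun i hi => by
    by_cases hij : i = j
    · rw [hij, h0]
    · exact hwJ i fun h => hi (Finset.mem_erase.2 ⟨hij, h⟩)
  have h1 : ∑ i ∈ J.erase j, w i • ω i = ∑ i, w i • ω i :=
    Finset.sum_subset (Finset.subset_univ _) fun i _ hi => by rw [hz i hi, zero_smul]
  have h2 := hω.mem j hj w (h1 ▸ hwW)
  have h3 : ∀ i, w i = 0 := fun i => by
    by_cases hi : i ∈ J.erase j
    · exact h2 i hi
    · exact hz i hi
  simp [h3] at hw1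

theorem IsGeneric.weight_unique {n d : ℕ} {W : Submodule ℝ (Euc d)} {I J : Finset (Fin n)}
    {ω : Fin n → Euc d} (hω : IsGeneric W I J ω) {w w' : Fin n → ℝ} (hwJ : ∀ i ∉ J, w i = 0)
    (hw1 : ∑ i, w i = 1) (hwW : ∑ i, w i • ω i ∈ W) (hwJ' : ∀ i ∉ J, w' i = 0)
    (hw1' : ∑ i, w' i = 1) (hwW' : ∑ i, w' i • ω i ∈ W) : w = w' := by
  by_contra hne
  obtain ⟨j, hj⟩ := Function.ne_iff.1 hne
  have hjJ : j ∈ J := by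
    by_contra h
    exact hj (by rw [hwJ j h, hwJ' j h])
  have hv : w j - w' j ≠ 0 := sub_ne_zero.2 hj
  set r := w j / (w j - w' j) with hr
  refine hω.weight_ne_zero (w := fun i => w i - r * (w i - w' i)) (fun i hi => ?_) ?_ ?_ hjJ ?_
  · simp [hwJ i hi, hwJ' i hi]
  · rw [Finset.sum_sub_distrib, ← Finset.mul_sum, Finset.sum_sub_distrib, hw1, hw1']
    ring
  · have : ∑ i, (w i - r * (w i - w' i)) • ω i =
        ∑ i, w i • ω i - r • (∑ i, w i • ω i - ∑ i, w' i • ω i) := by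
      rw [← Finset.sum_sub_distrib, Finset.smul_sum, ← Finset.sum_sub_distrib]
      refine Finset.sum_congr rfl fun i _ => ?_
      module
    rw [this]
    exact W.sub_mem hwW (W.smul_mem _ (W.sub_mem hwW hwW'))
  · rw [hr, div_mul_cancel₀ _ hv, sub_self]

theorem IsGeneric.exists_smul_eq {n d : ℕ} {W : Submodule ℝ (Euc d)} {J : Finset (Fin n)}
    {k : Fin n} (hk : k ∉ J) (hJ : J.card + 1 = d) {ω : Fin n → Euc d}
    (hω : IsGeneric W (insert k J) J ω) {c ψ : Euc d} (hψ0 : ψ ≠ 0)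
    (hc : ∀ l ∈ J, ⟪c, ω l - ω k⟫ = 0) (hψ : ∀ l ∈ J, ⟪ψ, ω l - ω k⟫ = 0) :
    ∃ κ : ℝ, c = κ • ψ := by
  set U := vectorSpan ℝ (Set.range fun i : (insert k J : Finset (Fin n)) => ω i) with hU
  have hdim : Module.finrank ℝ U = J.card :=
    hω.affineIndependent.finrank_vectorSpan (by
      rw [Fintype.card_coe, Finset.card_insert_of_notMem hk])
  have hperp : Module.finrank ℝ Uᗮ = 1 := by
    have := U.finrank_add_finrank_orthogonal
    rw [finrank_euclideanSpace_fin] at this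
    omega
  have hmem : ∀ v : Euc d, (∀ l ∈ J, ⟪v, ω l - ω k⟫ = 0) → v ∈ Uᗮ := fun v hv => by
    rw [Submodule.mem_orthogonal']
    intro u hu
    rw [hU, vectorSpan_range_eq_span_range_vsub_right ℝ _
      (⟨k, Finset.mem_insert_self k J⟩ : (insert k J : Finset (Fin n)))] at hu
    induction hu using Submodule.span_induction with
    | mem x hx =>
      obtain ⟨⟨l, hl⟩, rfl⟩ := hx
      rcases Finset.mem_insert.1 hl with rfl | hl
      · simp
      · exact hv l hl
    | zero => simp
    | add x y _ _ h1 h2 => rw [inner_add_right, h1, h2, add_zero]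
    | smul r x _ h1 => rw [inner_smul_right, h1, mul_zero]
  obtain ⟨κ, hκ⟩ := (finrank_eq_one_iff_of_nonzero' (⟨ψ, hmem ψ hψ⟩ : Uᗮ)
    (fun h => hψ0 (congrArg Subtype.val h))).1 hperp ⟨c, hmem c hc⟩
  exact ⟨κ, (congrArg Subtype.val hκ).symm⟩

/-- Translate all points indexed by `I` by `-t` times the difference of the points `j` and `k`. -/
def shear {n d : ℕ} (I : Finset (Fin n)) (j k : Fin n) (t : ℝ) :
    (Fin n → Euc d) →ₗ[ℝ] (Fin n → Euc d) where
  toFun ω i := if i ∈ I then ω i - t • (ω j - ω k) else ω i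
  map_add' ω η := by
    ext1 i
    by_cases h : i ∈ I <;> simp only [h, if_true, if_false, Pi.add_apply]
    module
  map_smul' r ω := by
    ext1 i
    by_cases h : i ∈ I <;> simp only [h, if_true, if_false, Pi.smul_apply, RingHom.id_apply]
    module

theorem shear_apply {n d : ℕ} (I : Finset (Fin n)) (j k : Fin n) (t : ℝ) (ω : Fin n → Euc d)
    (i : Fin n) : shear I j k t ω i = if i ∈ I then ω i - t • (ω j - ω k) else ω i := rfl

theorem shear_shear {n d : ℕ} {I : Finset (Fin n)} {j k : Fin n} (hj : j ∈ I) (hk : k ∈ I)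
    (t t' : ℝ) (ω : Fin n → Euc d) :
    shear I j k t (shear I j k t' ω) = shear I j k (t + t') ω := by
  ext1 i
  by_cases h : i ∈ I <;> simp only [shear_apply, h, hj, hk, if_true, if_false]
  module

theorem shear_zero {n d : ℕ} (I : Finset (Fin n)) (j k : Fin n) (ω : Fin n → Euc d) :
    shear I j k 0 ω = ω := by
  ext1 i
  simp [shear_apply]

theorem abs_det_shear {n d : ℕ} {I : Finset (Fin n)} {j k : Fin n} (hj : j ∈ I) (hk : k ∈ I)
    (t : ℝ) : |LinearMap.det (shear (d := d) I j k t)| = 1 := by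
  have h1 : LinearMap.det (shear (d := d) I j k t) * LinearMap.det (shear (d := d) I j k (-t)) =
      1 := by
    rw [← LinearMap.det_comp, ← LinearMap.det_id (A := ℝ) (M := Fin n → Euc d)]
    congr 1
    refine LinearMap.ext fun ω => ?_
    rw [LinearMap.comp_apply, shear_shear hj hk, add_neg_cancel, shear_zero, LinearMap.id_apply]
  have h2 : LinearMap.det (shear (d := d) I j k (-t)) = LinearMap.det (shear (d := d) I j k t) := by
    let e : (Fin n → Euc d) ≃ₗ[ℝ] (Fin n → Euc d) :=
      LinearEquiv.funCongrLeft ℝ (Euc d) (Equiv.swap j k)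
    rw [← LinearMap.det_conj (shear (d := d) I j k t) e]
    congr 1
    refine LinearMap.ext fun ω => ?_
    ext1 i
    have hswap : Equiv.swap j k i ∈ I ↔ i ∈ I := by
      by_cases h1 : i = j
      · simp [h1, hj, hk]
      by_cases h2 : i = k
      · simp [h2, hj, hk]
      rw [Equiv.swap_apply_of_ne_of_ne h1 h2]
    have he : ∀ η : Fin n → Euc d, ∀ l, e η l = η (Equiv.swap j k l) := fun η l => rfl
    have he' : ∀ η : Fin n → Euc d, ∀ l, e.symm η l = η (Equiv.swap j k l) := fun η l => by
      simp [e, LinearEquiv.funCongrLeft, LinearMap.funLeft]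
    simp only [LinearMap.comp_apply, LinearEquiv.coe_coe, he, shear_apply, hswap, he',
      Equiv.swap_apply_left, Equiv.swap_apply_right, Equiv.swap_apply_self]
    by_cases h : i ∈ I <;> simp only [h, if_true, if_false]
    module
  rw [h2] at h1
  have h3 : |LinearMap.det (shear (d := d) I j k t)| ^ 2 = 1 := by rw [sq_abs, sq, h1]
  exact (pow_eq_one_iff_of_nonneg (abs_nonneg _) two_ne_zero).1 h3

theorem lintegral_comp_shear {n d : ℕ} {I : Finset (Fin n)} {j k : Fin n} (hj : j ∈ I)
    (hk : k ∈ I) (t : ℝ) {H : (Fin n → Euc d) → ℝ≥0∞} (hH : Measurable H) :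
    ∫⁻ ω, H (shear I j k t ω) = ∫⁻ ω, H ω := by
  have hdet := abs_det_shear (d := d) hj hk t
  have hd : LinearMap.det (shear (d := d) I j k t) ≠ 0 := fun h => by simp [h] at hdet
  have hm : Measurable (shear (d := d) I j k t) :=
    (shear (d := d) I j k t).continuous_of_finiteDimensional.measurable
  rw [← lintegral_map hH hm, Measure.map_linearMap_addHaar_eq_smul_addHaar volume hd,
    abs_inv, hdet]
  simp

/-- The effect of `shear` on barycentric weights. -/
def shiftWeight {n : ℕ} (j k : Fin n) (t : ℝ) (w : Fin n → ℝ) : Fin n → ℝ :=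
  w + t • (Pi.single j 1 - Pi.single k 1)

theorem sum_shiftWeight {n : ℕ} (j k : Fin n) (t : ℝ) (w : Fin n → ℝ) :
    ∑ i, shiftWeight j k t w i = ∑ i, w i := by
  simp [shiftWeight, Finset.sum_add_distrib, ← Finset.mul_sum, Finset.sum_sub_distrib]

theorem shiftWeight_eq_zero {n : ℕ} {J : Finset (Fin n)} {j k : Fin n} (hj : j ∈ J) (hk : k ∈ J)
    (t : ℝ) {w : Fin n → ℝ} (hw : ∀ i ∉ J, w i = 0) : ∀ i ∉ J, shiftWeight j k t w i = 0 :=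
  fun i hi => by
    have h1 : i ≠ j := fun h => hi (h ▸ hj)
    have h2 : i ≠ k := fun h => hi (h ▸ hk)
    simp [shiftWeight, hw i hi, h1, h2]

theorem sum_shiftWeight_smul_shear {n d : ℕ} {I J : Finset (Fin n)} (hJI : J ⊆ I) {j k : Fin n}
    (hj : j ∈ J) (hk : k ∈ J) (t : ℝ) {w : Fin n → ℝ} (hw : ∀ i ∉ J, w i = 0)
    (hw1 : ∑ i, w i = 1) (ω : Fin n → Euc d) :
    ∑ i, shiftWeight j k t w i • shear I j k t ω i = ∑ i, w i • ω i := by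
  have h0 := shiftWeight_eq_zero hj hk t hw
  have h1 : ∀ i, shiftWeight j k t w i • shear I j k t ω i =
      shiftWeight j k t w i • ω i - (shiftWeight j k t w i * t) • (ω j - ω k) := fun i => by
    by_cases hi : i ∈ J
    · rw [shear_apply, if_pos (hJI hi)]
      module
    · simp [h0 i hi]
  simp_rw [h1]
  rw [Finset.sum_sub_distrib, ← Finset.sum_smul, ← Finset.sum_mul, sum_shiftWeight, hw1, one_mul]
  have h2 : ∀ i, shiftWeight j k t w i • ω i = w i • ω i +
      ((t * (Pi.single j (1 : ℝ) : Fin n → ℝ) i) • ω i -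
        (t * (Pi.single k (1 : ℝ) : Fin n → ℝ) i) • ω i) := fun i => by
    simp only [shiftWeight, Pi.add_apply, Pi.smul_apply, Pi.sub_apply, smul_eq_mul]
    module
  simp_rw [h2]
  rw [Finset.sum_add_distrib, Finset.sum_sub_distrib]
  simp [Pi.single_apply, smul_sub]

theorem measure_smallWeight_le {n d : ℕ} {L : ℝ} (hL : 0 < L)
    {W : Submodule ℝ (Euc d)} {f : Fin n → Euc d → ℝ} (hf : ∀ i, IsLogLipschitz L (f i))
    {I J : Finset (Fin n)} (hI : I.card = d) (hJI : J ⊆ I)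
    {j k : Fin n} (hj : j ∈ J) (hk : k ∈ J) (hjk : j ≠ k) {δ : ℝ} (hδ : 0 < δ) {M : ℕ}
    (hM : M * δ ≤ 1 / d)
    {B : Set (Fin n → Euc d)} (hB : MeasurableSet B)
    (hBw : B ⊆ weightEvent W I J {w | w j ≤ δ ∧ 1 / d ≤ w k})
    (hBg : ∀ ω ∈ B, IsGeneric W I J ω) (hBD : ∀ ω ∈ B, ∀ i l, dist (ω i) (ω l) ≤ 3) :
    M * productDensityMeasure f B ≤
      ENNReal.ofReal (Real.exp (L * (d * (3 * (M * δ))))) *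
        productDensityMeasure f (supportEvent W I J) := by
  have hdens := measurable_jointDensity hf
  have hjI := hJI hj
  have hkI := hJI hk
  set A : ℕ → Set (Fin n → Euc d) := fun m => shear I j k (-(m * δ)) ⁻¹' B with hA
  have hcont : ∀ t, Measurable (shear (d := d) I j k t) := fun t =>
    (shear (d := d) I j k t).continuous_of_finiteDimensional.measurable
  have hAm : ∀ m, MeasurableSet (A m) := fun m => hcont _ hB
  set C := ENNReal.ofReal (Real.exp (L * (d * (3 * (M * δ))))) with hC
  have hle : ∀ m ∈ Finset.range M, productDensityMeasure f B ≤ C * productDensityMeasure f (A m) :=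
      fun m hm => by
    have hmM : (m : ℝ) ≤ M := by exact_mod_cast (Finset.mem_range.1 hm).le
    rw [productDensityMeasure_apply f hB, productDensityMeasure_apply f (hAm m),
      ← lintegral_const_mul _ (hdens.indicator (hAm m)),
      ← lintegral_comp_shear hjI hkI (-(m * δ)) (hdens.indicator hB)]
    refine lintegral_mono fun ω => ?_
    by_cases hω : shear I j k (-(m * δ)) ω ∈ B
    swap
    · rw [indicator_of_notMem hω]; exact zero_le
    rw [indicator_of_mem hω, indicator_of_mem (show ω ∈ A m from hω)]
    refine jointDensity_le hL hf ?_
    set η := shear I j k (-(m * δ)) ω with hη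
    have hωη : ω = shear I j k (m * δ) η := by
      rw [hη, shear_shear hjI hkI, add_neg_cancel, shear_zero]
    have h1 : ∀ i, ‖η i - ω i‖ ≤ if i ∈ I then 3 * (M * δ) else 0 := fun i => by
      rw [hωη, shear_apply]
      split_ifs with hi
      · rw [sub_sub_cancel, norm_smul, ← dist_eq_norm, Real.norm_of_nonneg (by positivity), mul_comm]
        exact mul_le_mul (hBD η hω j k) (by gcongr) (by positivity) (by norm_num)
      · simp
    refine (Finset.sum_le_sum fun i _ => h1 i).trans_eq ?_
    rw [Finset.sum_ite_mem, Finset.univ_inter, Finset.sum_const, hI, nsmul_eq_mul]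
  have hdisj : (Finset.range M : Set ℕ).PairwiseDisjoint A := by
    have aux : ∀ m m' : ℕ, m < m' → ∀ ω, ω ∈ A m → ω ∈ A m' → False := fun m m' hlt ω h1 h2 => by
      obtain ⟨-, -, w, -, -, ⟨h3, h4, h5⟩, h6, h7, -⟩ := hBw h1
      obtain ⟨-, -, w', -, -, ⟨h3', h4', h5'⟩, h6', -, -⟩ := hBw h2
      set t := (m' * δ - m * δ) with ht
      have htδ : δ ≤ t := by
        have : (m : ℝ) + 1 ≤ m' := by exact_mod_cast hlt
        rw [ht]; nlinarith
      have heq : shear I j k (-(m * δ)) ω = shear I j k t (shear I j k (-(m' * δ)) ω) := by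
        rw [shear_shear hjI hkI, ht]
        congr 1
        congr 1
        ring
      have hww : w = shiftWeight j k t w' := by
        refine (hBg _ h1).weight_unique h4 h5 h6 (shiftWeight_eq_zero hj hk t h4')
          ((sum_shiftWeight j k t w').trans h5') ?_
        rw [heq, sum_shiftWeight_smul_shear hJI hj hk t h4' h5']
        exact h6'
      have hpos : 0 < w' j := (h3' j hj).lt_of_ne ((hBg _ h2).weight_ne_zero h4' h5' h6' hj).symm
      have : w j = w' j + t := by rw [hww]; simp [shiftWeight, hjk]
      linarith
    intro m _ m' _ hmm
    refine Set.disjoint_left.2 fun ω h1 h2 => ?_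
    rcases lt_or_gt_of_ne hmm with h | h
    · exact aux m m' h ω h1 h2
    · exact aux m' m h ω h2 h1
  have hsub : ⋃ m ∈ Finset.range M, A m ⊆ supportEvent W I J := by
    refine iUnion₂_subset fun m hm ω hω => ?_
    have hmM : (m : ℝ) ≤ M := by exact_mod_cast (Finset.mem_range.1 hm).le
    obtain ⟨c, h, w, h1, h2, ⟨h3, h4, h5⟩, h6, h7, h8⟩ := hBw hω
    set η := shear I j k (-(m * δ)) ω with hη
    have hωη : ω = shear I j k (m * δ) η := by
      rw [hη, shear_shear hjI hkI, add_neg_cancel, shear_zero]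
    have hcω : ∀ i, ⟪c, ω i⟫ = ⟪c, η i⟫ := fun i => by
      rw [hωη, shear_apply]
      split_ifs with hi
      · rw [inner_sub_right, inner_smul_right, inner_sub_right, h1 j hjI, h1 k hkI]
        simp
      · rfl
    refine ⟨c, h, shiftWeight j k (m * δ) w, fun i hi => (hcω i).trans (h1 i hi),
      fun l hl => (hcω l).trans_lt (h2 l hl), fun i hi => ?_, shiftWeight_eq_zero hj hk _ h4,
      (sum_shiftWeight j k _ w).trans h5, ?_⟩
    · have hw := h3 i hi
      have hmδ : 0 ≤ m * δ := by positivity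
      by_cases hik : i = k
      · have : m * δ ≤ M * δ := by gcongr
        rw [hik]
        simp only [shiftWeight, Pi.add_apply, Pi.smul_apply, Pi.sub_apply, smul_eq_mul,
          Pi.single_eq_same, Pi.single_eq_of_ne hjk.symm]
        linarith
      · have : 0 ≤ (Pi.single j (1 : ℝ) : Fin n → ℝ) i := by
          rw [Pi.single_apply]; split_ifs <;> norm_num
        simp only [shiftWeight, Pi.add_apply, Pi.smul_apply, Pi.sub_apply, smul_eq_mul,
          Pi.single_eq_of_ne hik, sub_zero]
        positivity
    · rw [hωη, sum_shiftWeight_smul_shear hJI hj hk _ h4 h5]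
      exact h6
  calc M * productDensityMeasure f B
      = ∑ _m ∈ Finset.range M, productDensityMeasure f B := by simp
    _ ≤ ∑ m ∈ Finset.range M, C * productDensityMeasure f (A m) := Finset.sum_le_sum hle
    _ = C * productDensityMeasure f (⋃ m ∈ Finset.range M, A m) := by
        rw [measure_biUnion_finset hdisj fun m _ => hAm m, Finset.mul_sum]
    _ ≤ _ := mul_le_mul_right (measure_mono hsub) _

theorem mem_convexHull_image_iff {n d : ℕ} {ω : Fin n → Euc d} {K : Finset (Fin n)} {x : Euc d} :
    x ∈ convexHull ℝ (ω '' K) ↔ ∃ w : Fin n → ℝ, (∀ i ∈ K, 0 ≤ w i) ∧ (∀ i ∉ K, w i = 0) ∧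
      ∑ i, w i = 1 ∧ ∑ i, w i • ω i = x := by
  constructor
  · intro hx
    refine convexHull_min (s := ω '' K) (t := {x | ∃ w : Fin n → ℝ, (∀ i ∈ K, 0 ≤ w i) ∧
      (∀ i ∉ K, w i = 0) ∧ ∑ i, w i = 1 ∧ ∑ i, w i • ω i = x}) ?_ ?_ hx
    · rintro _ ⟨j, hj, rfl⟩
      refine ⟨Pi.single j 1, fun i _ => ?_, fun i hi => ?_, by simp, by simp [Pi.single_apply]⟩
      · rw [Pi.single_apply]; split_ifs <;> norm_num
      · exact Pi.single_eq_of_ne (ne_of_mem_of_not_mem hj hi).symm _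
    · rintro _ ⟨w, h1, h2, h3, rfl⟩ _ ⟨w', h1', h2', h3', rfl⟩ a b ha hb hab
      refine ⟨fun i => a * w i + b * w' i, fun i hi => ?_, fun i hi => ?_, ?_, ?_⟩
      · have := h1 i hi; have := h1' i hi; positivity
      · simp [h2 i hi, h2' i hi]
      · rw [Finset.sum_add_distrib, ← Finset.mul_sum, ← Finset.mul_sum, h3, h3', mul_one, mul_one,
          hab]
      · rw [Finset.smul_sum, Finset.smul_sum, ← Finset.sum_add_distrib]
        refine Finset.sum_congr rfl fun i _ => ?_
        module
  · rintro ⟨w, h1, h2, h3, rfl⟩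
    have hs : ∀ g : Fin n → Euc d, ∑ i, w i • g i = ∑ i ∈ K, w i • g i := fun g =>
      (Finset.sum_subset (Finset.subset_univ _) fun i _ hi => by rw [h2 i hi, zero_smul]).symm
    rw [hs]
    refine (convex_convexHull ℝ _).sum_mem h1 ?_ fun i hi =>
      subset_convexHull ℝ _ (mem_image_of_mem ω hi)
    rw [← h3]
    exact Finset.sum_subset (Finset.subset_univ _) fun i _ hi => h2 i hi

theorem exists_eq_sum_of_mem_affineSpan_image {n d : ℕ} {ω : Fin n → Euc d} {K : Finset (Fin n)}
    {x : Euc d} (hx : x ∈ affineSpan ℝ (ω '' K)) :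
    ∃ w : Fin n → ℝ, (∀ i ∉ K, w i = 0) ∧ ∑ i, w i = 1 ∧ ∑ i, w i • ω i = x := by
  rw [image_eq_range] at hx
  obtain ⟨w, hw, rfl⟩ := eq_affineCombination_of_mem_affineSpan_of_fintype hx
  rw [Finset.affineCombination_eq_linear_combination _ _ _ hw]
  refine ⟨fun i => if h : i ∈ K then w ⟨i, h⟩ else 0, fun i hi => dif_neg hi, ?_, ?_⟩
  · rw [← hw, ← Finset.sum_subset (Finset.subset_univ K) fun i _ hi => dif_neg hi,
      ← Finset.sum_coe_sort K]
    exact Finset.sum_congr rfl fun i _ => dif_pos i.2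
  · rw [← Finset.sum_subset (Finset.subset_univ K) fun i _ hi => by
        simp only [dif_neg hi, zero_smul],
      ← Finset.sum_coe_sort K]
    exact Finset.sum_congr rfl fun i _ => by simp only [dif_pos i.2]; rfl

theorem isExposed_convexHull_image {n d : ℕ} {ω : Fin n → Euc d} {K : Finset (Fin n)} {c : Euc d}
    {h : ℝ} (hK : ∀ i ∈ K, ⟪c, ω i⟫ = h) (hlt : ∀ l ∉ K, ⟪c, ω l⟫ < h) :
    IsExposed ℝ (convexHull ℝ (range ω)) (convexHull ℝ (ω '' K)) := by
  intro hne
  obtain ⟨_, i₀, hi₀, -⟩ := convexHull_nonempty_iff.1 hne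
  have hle : ∀ y ∈ convexHull ℝ (range ω), ⟪c, y⟫ ≤ h := by
    intro y hy
    rw [← image_univ, ← Finset.coe_univ, mem_convexHull_image_iff] at hy
    obtain ⟨w, h1, -, h3, rfl⟩ := hy
    rw [inner_sum, ← one_mul h, ← h3, Finset.sum_mul]
    refine Finset.sum_le_sum fun i hi => ?_
    rw [inner_smul_right]
    refine mul_le_mul_of_nonneg_left ?_ (h1 i hi)
    by_cases hiK : i ∈ K
    · exact (hK i hiK).le
    · exact (hlt i hiK).le
  refine ⟨innerSL ℝ c, Set.ext fun x => ⟨fun hx => ⟨convexHull_mono (image_subset_range _ _) hx,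
    fun y hy => ?_⟩, fun ⟨hx, hmax⟩ => ?_⟩⟩
  · obtain ⟨w, -, h2, h3, rfl⟩ := mem_convexHull_image_iff.1 hx
    simp only [innerSL_apply_apply]
    refine (hle y hy).trans_eq ?_
    rw [inner_sum, ← one_mul h, ← h3, Finset.sum_mul]
    refine Finset.sum_congr rfl fun i _ => ?_
    rw [inner_smul_right]
    by_cases hiK : i ∈ K
    · rw [hK i hiK]
    · rw [h2 i hiK, zero_mul, zero_mul]
  · have hx' := hx
    rw [← image_univ, ← Finset.coe_univ, mem_convexHull_image_iff] at hx
    obtain ⟨w, h1, -, h3, rfl⟩ := hx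
    have hge : h ≤ ⟪c, ∑ i, w i • ω i⟫ := by
      have := hmax (ω i₀) (subset_convexHull ℝ _ (mem_range_self i₀))
      simpa only [innerSL_apply_apply, hK i₀ hi₀] using this
    have hterm : ∀ i ∈ Finset.univ, 0 ≤ w i * (h - ⟪c, ω i⟫) := fun i hi => by
      refine mul_nonneg (h1 i hi) ?_
      by_cases hiK : i ∈ K
      · rw [hK i hiK, sub_self]
      · exact (sub_pos.2 (hlt i hiK)).le
    have hsum : ∑ i, w i * (h - ⟪c, ω i⟫) ≤ 0 := by
      simp only [mul_sub, Finset.sum_sub_distrib, ← Finset.sum_mul, h3, one_mul]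
      rw [inner_sum] at hge
      simp only [inner_smul_right] at hge
      linarith
    have hzero := (Finset.sum_eq_zero_iff_of_nonneg hterm).1
      (le_antisymm hsum (Finset.sum_nonneg hterm))
    refine mem_convexHull_image_iff.2 ⟨w, fun i _ => h1 i (Finset.mem_univ i), fun i hi => ?_, h3,
      rfl⟩
    exact (mul_eq_zero.1 (hzero i (Finset.mem_univ i))).resolve_right (sub_pos.2 (hlt i hi)).ne'

theorem IsGeneric.finrank_vectorSpan_convexHull {n d : ℕ} {W : Submodule ℝ (Euc d)}
    {I J K : Finset (Fin n)} {ω : Fin n → Euc d} (hω : IsGeneric W I J ω) (hKI : K ⊆ I) {m : ℕ}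
    (hm : K.card = m + 1) : Module.finrank ℝ (vectorSpan ℝ (convexHull ℝ (ω '' K))) = m := by
  rw [← direction_affineSpan, affineSpan_convexHull, direction_affineSpan, image_eq_range]
  have hK : AffineIndependent ℝ (fun i : K => ω i) :=
    hω.affineIndependent.comp_embedding
      ⟨fun i : K => (⟨i, hKI i.2⟩ : I), fun i j h => Subtype.ext (congrArg (fun x : I => x.1) h)⟩
  exact hK.finrank_vectorSpan (by rw [Fintype.card_coe, hm])

theorem IsGeneric.exists_dual {n d : ℕ} {W : Submodule ℝ (Euc d)} {I J : Finset (Fin n)}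
    (hI : I.card = d) {ω : Fin n → Euc d} (hω : IsGeneric W I J ω) :
    ∃ v : Fin n → Euc d, ∀ i ∈ I, ∀ j ∈ I, ⟪v i, ω j⟫ = if j = i then (1 : ℝ) else 0 := by
  have hli : LinearIndependent ℝ (fun i : I => ω i) := linearIndepOn_finset_iff.2 hω.linear
  let b := basisOfLinearIndependentOfCardEqFinrank' (fun i : I => ω i) hli
    (by rw [Fintype.card_coe, hI, finrank_euclideanSpace_fin])
  have hb : ∀ i : I, b i = ω i := fun i => by
    rw [coe_basisOfLinearIndependentOfCardEqFinrank']
  refine ⟨fun i => if h : i ∈ I then (InnerProductSpace.toDual ℝ (Euc d)).symm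
    (LinearMap.toContinuousLinearMap (b.coord ⟨i, h⟩)) else 0, fun i hi j hj => ?_⟩
  simp only [dif_pos hi, InnerProductSpace.toDual_symm_apply]
  have := hb ⟨j, hj⟩
  simp only at this
  rw [← this]
  simp [Finsupp.single_apply]

theorem IsGeneric.mem_edgeEvent_inter_vertexEvent {n d : ℕ} {W : Submodule ℝ (Euc d)}
    (hd : 2 ≤ d) {I J : Finset (Fin n)} (hI : I.card = d) (hJI : J ⊆ I) (hJ : J.card + 1 = d)
    {ω : Fin n → Euc d} (hω : IsGeneric W I J ω) (hIu : I ≠ Finset.univ)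
    (hS : ω ∈ supportEvent W I J) : ω ∈ edgeEvent W I ∩ vertexEvent W J := by
  obtain ⟨c, h, w, hc, hlt, hw0, hwJ, hw1, hwW⟩ := hS
  have hJm : ∑ i, w i • ω i ∈ convexHull ℝ (ω '' J) :=
    mem_convexHull_image_iff.2 ⟨w, hw0, hwJ, hw1, rfl⟩
  refine ⟨⟨⟨isExposed_convexHull_image hc hlt, fun heq => ?_, ?_⟩, _,
    convexHull_mono (image_mono hJI) hJm, hwW⟩, ⟨?_, ?_⟩, _, hJm, hwW⟩
  · obtain ⟨l, hl⟩ : ∃ l, l ∉ I := by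
      by_contra! hall
      exact hIu (Finset.eq_univ_iff_forall.2 hall)
    have hmem : ω l ∈ convexHull ℝ (ω '' I) := by
      rw [heq]
      exact subset_convexHull ℝ _ (mem_range_self l)
    obtain ⟨τ, -, h2, h3, h4⟩ := mem_convexHull_image_iff.1 hmem
    have hsub : ∀ i ∈ Finset.univ, i ∉ I → τ i = 0 := fun i _ hi => h2 i hi
    refine hω.affine l hl τ ?_ ?_
    · rw [Finset.sum_subset (Finset.subset_univ _) hsub, h3]
    · rw [← h4]
      exact (Finset.sum_subset (Finset.subset_univ _) fun i hi hiI => by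
        rw [hsub i hi hiI, zero_smul]).symm
  · rw [hω.finrank_vectorSpan_convexHull subset_rfl (m := d - 1) (by omega)]
    omega
  · obtain ⟨k, hkI, hkJ⟩ : ∃ k ∈ I, k ∉ J := by
      by_contra! hall
      have := Finset.card_le_card (show I ⊆ J from hall)
      omega
    have hIJ : ∀ i ∈ I, i ≠ k → i ∈ J := by
      have : insert k J = I := Finset.eq_of_subset_of_card_le
        (Finset.insert_subset hkI hJI) (by rw [Finset.card_insert_of_notMem hkJ]; omega)
      intro i hi hik
      rw [← this] at hi
      exact (Finset.mem_insert.1 hi).resolve_left hik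
    obtain ⟨v, hv⟩ := hω.exists_dual hI
    have hev : ∀ᶠ t : ℝ in nhds 0, ∀ l, l ∉ I → ⟪c - t • v k, ω l⟫ < h := by
      refine Filter.eventually_all.2 fun l => ?_
      by_cases hl : l ∈ I
      · exact Filter.Eventually.of_forall fun t h => absurd hl h
      · have hcont : Continuous fun t : ℝ => ⟪c - t • v k, ω l⟫ := by fun_prop
        refine (hcont.continuousAt.eventually_lt_const (u := h) ?_).mono fun t ht _ => ht
        simpa using hlt l hl
    obtain ⟨t, ht, ht0⟩ := ((hev.filter_mono nhdsWithin_le_nhds).and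
      (self_mem_nhdsWithin : Ioi (0 : ℝ) ∈ nhdsWithin 0 (Ioi 0))).exists
    refine isExposed_convexHull_image (c := c - t • v k) (h := h) (fun i hi => ?_) fun l hl => ?_
    · rw [inner_sub_left, inner_smul_left, hv k hkI i (hJI hi),
        if_neg (ne_of_mem_of_not_mem hi hkJ), hc i (hJI hi)]
      simp
    · by_cases hlI : l ∈ I
      · have hlk : l = k := by
          by_contra hlk
          exact hl (hIJ l hlI hlk)
        rw [hlk, inner_sub_left, inner_smul_left, hv k hkI k hkI, hc k hkI]
        simpa using ht0
      · exact ht l hlI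
  · rw [hω.finrank_vectorSpan_convexHull hJI (m := d - 2) (by omega)]
    omega

theorem IsGeneric.mem_supportEvent {n d : ℕ} {W : Submodule ℝ (Euc d)} {I J : Finset (Fin n)}
    {ω : Fin n → Euc d} (hω : IsGeneric W I J ω) (hI : I.Nonempty)
    (hs : ω ∈ edgeEvent W I ∩ vertexEvent W J) : ω ∈ supportEvent W I J := by
  obtain ⟨⟨⟨hexp, -, -⟩, -⟩, -, x, hx, hxW⟩ := hs
  obtain ⟨w, h1, h2, h3, rfl⟩ := mem_convexHull_image_iff.1 hx
  obtain ⟨i₀, hi₀⟩ := hI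
  have hmem : ∀ i ∈ I, ω i ∈ convexHull ℝ (ω '' I) := fun i hi =>
    subset_convexHull ℝ _ (mem_image_of_mem ω hi)
  have hran : ∀ i, ω i ∈ convexHull ℝ (range ω) := fun i =>
    subset_convexHull ℝ _ (mem_range_self i)
  obtain ⟨φ, hφ⟩ := hexp ⟨_, hmem i₀ hi₀⟩
  have hmax : ∀ i ∈ I, ∀ y ∈ convexHull ℝ (range ω), φ y ≤ φ (ω i) := fun i hi => by
    have := hmem i hi
    rw [hφ] at this
    exact this.2
  refine ⟨(InnerProductSpace.toDual ℝ (Euc d)).symm φ, φ (ω i₀), w, fun i hi => ?_, fun l hl => ?_,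
    h1, h2, h3, hxW⟩
  · rw [InnerProductSpace.toDual_symm_apply]
    exact le_antisymm (hmax i₀ hi₀ _ (hran i)) (hmax i hi _ (hran i₀))
  · rw [InnerProductSpace.toDual_symm_apply]
    refine (hmax i₀ hi₀ _ (hran l)).lt_of_ne fun heq => ?_
    have hlm : ω l ∈ convexHull ℝ (ω '' I) := by
      rw [hφ]
      exact ⟨hran l, fun y hy => heq ▸ hmax i₀ hi₀ y hy⟩
    obtain ⟨τ, -, h2, h3, h4⟩ := mem_convexHull_image_iff.1 hlm
    have hsub : ∀ i ∈ Finset.univ, i ∉ I → τ i = 0 := fun i _ hi => h2 i hi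
    refine hω.affine l hl τ ?_ ?_
    · rw [Finset.sum_subset (Finset.subset_univ _) hsub, h3]
    · rw [← h4]
      exact (Finset.sum_subset (Finset.subset_univ _) fun i hi hiI => by
        rw [hsub i hi hiI, zero_smul]).symm

theorem IsGeneric.exists_of_mem_intrinsicFrontier {n d : ℕ} {W : Submodule ℝ (Euc d)}
    {I J : Finset (Fin n)} (hI : I.card = d) (hJI : J ⊆ I) {ω : Fin n → Euc d}
    (hω : IsGeneric W I J ω) {z : Euc d} (hz : z ∈ intrinsicFrontier ℝ (convexHull ℝ (ω '' J))) :
    ∃ j ∈ J, ∃ w : Fin n → ℝ, (∀ i ∈ J, 0 ≤ w i) ∧ (∀ i ∉ J, w i = 0) ∧ w j = 0 ∧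
      ∑ i, w i = 1 ∧ ∑ i, w i • ω i = z := by
  have hcl : IsClosed (convexHull ℝ (ω '' J)) := (J.finite_toSet.image ω).isClosed_convexHull ℝ
  obtain ⟨w, h1, h2, h3, rfl⟩ := mem_convexHull_image_iff.1 (intrinsicFrontier_subset hcl hz)
  by_contra! hcon
  have hpos : ∀ j ∈ J, 0 < w j := fun j hj =>
    (h1 j hj).lt_of_ne fun h0 => hcon j hj w h1 h2 h0.symm h3 rfl
  obtain ⟨v, hv⟩ := hω.exists_dual hI
  have hcoord : ∀ τ : Fin n → ℝ, (∀ i ∉ J, τ i = 0) → ∀ j ∈ J, ⟪v j, ∑ i, τ i • ω i⟫ = τ j := by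
    intro τ hτ j hj
    rw [inner_sum, Finset.sum_eq_single j]
    · rw [inner_smul_right, hv j (hJI hj) j (hJI hj), if_pos rfl, mul_one]
    · intro i _ hij
      by_cases hi : i ∈ J
      · rw [inner_smul_right, hv j (hJI hj) i (hJI hi), if_neg hij, mul_zero]
      · rw [hτ i hi, zero_smul, inner_zero_right]
    · exact fun h => absurd (Finset.mem_univ j) h
  rw [← intrinsicClosure_sdiff_intrinsicInterior] at hz
  refine hz.2 (mem_intrinsicInterior.2 ?_)
  refine ⟨⟨_, subset_affineSpan ℝ _ (mem_convexHull_image_iff.2 ⟨w, h1, h2, h3, rfl⟩)⟩, ?_, rfl⟩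
  refine mem_interior.2 ⟨{y | ∀ j ∈ J, 0 < ⟪v j, (y : Euc d)⟫}, fun y hy => ?_, ?_, fun j hj => ?_⟩
  · have hy' : (y : Euc d) ∈ affineSpan ℝ (ω '' J) :=
      (affineSpan_convexHull (𝕜 := ℝ) (ω '' J)).le y.2
    obtain ⟨τ, h4, h5, h6⟩ := exists_eq_sum_of_mem_affineSpan_image hy'
    refine mem_convexHull_image_iff.2 ⟨τ, fun i hi => ?_, h4, h5, h6⟩
    rw [← hcoord τ h4 i hi, h6]
    exact (hy i hi).le
  · have : {y : affineSpan ℝ (convexHull ℝ (ω '' J)) | ∀ j ∈ J, 0 < ⟪v j, (y : Euc d)⟫} =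
        ⋂ j ∈ J, {y : affineSpan ℝ (convexHull ℝ (ω '' J)) | 0 < ⟪v j, (y : Euc d)⟫} := by
      ext y; simp
    rw [this]
    refine isOpen_biInter_finset fun j _ => isOpen_lt continuous_const ?_
    fun_prop
  · rw [hcoord w h2 j hj]
    exact hpos j hj

theorem inner_sum_smul_eq_of_const {n d : ℕ} {I : Finset (Fin n)} {ω : Fin n → Euc d} {v : Euc d}
    {C : ℝ} (hv : ∀ i ∈ I, ⟪v, ω i⟫ = C) {w : Fin n → ℝ} (hw : ∀ i ∉ I, w i = 0)
    (hw1 : ∑ i, w i = 1) : ⟪v, ∑ i, w i • ω i⟫ = C := by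
  rw [inner_sum, ← one_mul C, ← hw1, Finset.sum_mul]
  refine Finset.sum_congr rfl fun i _ => ?_
  rw [inner_smul_right]
  by_cases hi : i ∈ I
  · rw [hv i hi]
  · rw [hw i hi, zero_mul, zero_mul]

theorem inner_sum_smul_eq_pair {n d : ℕ} {J : Finset (Fin n)} {ω : Fin n → Euc d} {u : Euc d}
    {i j : Fin n} (hij : i ≠ j) (hu : ∀ l ∈ J, l ≠ i → l ≠ j → ⟪u, ω l⟫ = 0) {w : Fin n → ℝ}
    (hw : ∀ l ∉ J, w l = 0) : ⟪u, ∑ l, w l • ω l⟫ = w i * ⟪u, ω i⟫ + w j * ⟪u, ω j⟫ := by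
  rw [inner_sum, ← Finset.sum_pair (f := fun l => w l * ⟪u, ω l⟫) hij,
    ← Finset.sum_subset (Finset.subset_univ ({i, j} : Finset (Fin n)))]
  · exact Finset.sum_congr rfl fun l _ => inner_smul_right _ _ _
  · intro l _ hl
    rw [Finset.mem_insert, Finset.mem_singleton, not_or] at hl
    rw [inner_smul_right]
    by_cases hlJ : l ∈ J
    · rw [hu l hlJ hl.1 hl.2, mul_zero]
    · rw [hw l hlJ, zero_mul]

theorem weight_mul_le_of_notMem_flatEvent {n d : ℕ} {W : Submodule ℝ (Euc d)}
    {I J : Finset (Fin n)} (hJI : J ⊆ I) {ω : Fin n → Euc d} {w τ σ : Fin n → ℝ}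
    (hw0 : ∀ i ∈ J, 0 ≤ w i) (hwJ : ∀ i ∉ J, w i = 0) (hw1 : ∑ i, w i = 1)
    (hwW : ∑ i, w i • ω i ∈ W) (hτI : ∀ i ∉ I, τ i = 0) (hτ1 : ∑ i, τ i = 1)
    (hτW : ∑ i, τ i • ω i ∈ W) (hσ0 : ∀ i ∈ J, 0 ≤ σ i) (hσJ : ∀ i ∉ J, σ i = 0)
    (hσ1 : ∑ i, σ i = 1) {j : Fin n} (hj : j ∈ J) (hσj : σ j = 0) {ε δ : ℝ}
    (hε : dist (∑ i, τ i • ω i) (∑ i, σ i • ω i) ≤ ε)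
    {i : Fin n} (hi : i ∈ J) (hij : i ≠ j) (hflat : ω ∉ flatEvent W I J i j δ) :
    σ i * (w j * δ) ≤ ε * (w i + w j) := by
  simp only [flatEvent, Set.mem_ofPred_eq, not_forall, not_le] at hflat
  obtain ⟨u, m, huW, hu, hum, hlt⟩ := hflat
  have huW' := fun x hx => Submodule.inner_left_of_mem_orthogonal (u := x) (v := u) (K := W) hx huW
  have hconst : ∀ l ∈ I, ⟪u - m, ω l⟫ = ⟪u - m, ω j⟫ := fun l hl => by
    have := hum l hl j (hJI hj)
    rwa [inner_sub_right, sub_eq_zero] at this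
  have hwI : ∀ i ∉ I, w i = 0 := fun i hi => hwJ i fun h => hi (hJI h)
  have hσI : ∀ i ∉ I, σ i = 0 := fun i hi => hσJ i fun h => hi (hJI h)
  have hbal : w i * ⟪u, ω i⟫ + w j * ⟪u, ω j⟫ = 0 := by
    rw [← inner_sum_smul_eq_pair hij hu hwJ]
    exact huW' _ hwW
  have hm : 0 < ‖m‖ := by
    refine (norm_nonneg m).lt_of_ne fun h0 => ?_
    have hm0 : m = 0 := norm_eq_zero.1 h0.symm
    rw [hm0, sub_zero] at hconst
    have hz : ⟪u, ω j⟫ = 0 := by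
      rw [← inner_sum_smul_eq_of_const hconst hwI hw1]
      exact huW' _ hwW
    rw [hconst i (hJI hi), hz, hm0] at hlt
    simp at hlt
  have hσu : ⟪u, ∑ l, σ l • ω l⟫ = σ i * ⟪u, ω i⟫ := by
    rw [inner_sum_smul_eq_pair hij hu hσJ, hσj, zero_mul, add_zero]
  have hle : σ i * |⟪u, ω i⟫| ≤ ‖m‖ * ε := by
    have h1 : ⟪m, ∑ l, τ l • ω l - ∑ l, σ l • ω l⟫ = -(σ i * ⟪u, ω i⟫) := by
      have h2 := inner_sum_smul_eq_of_const hconst hτI hτ1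
      have h3 := inner_sum_smul_eq_of_const hconst hσI hσ1
      have h4 := huW' _ hτW
      rw [inner_sub_left] at h2 h3
      rw [inner_sub_right]
      linarith
    rw [← abs_of_nonneg (hσ0 i hi), ← abs_mul, ← abs_neg, ← h1]
    refine (abs_real_inner_le_norm _ _).trans ?_
    rw [← dist_eq_norm]
    gcongr
  have hwi := hw0 i hi
  have hwj := hw0 j hj
  have habs : w i * |⟪u, ω i⟫| = w j * |⟪u, ω j⟫| := by
    rw [← abs_of_nonneg hwi, ← abs_mul, ← abs_of_nonneg hwj, ← abs_mul, ← abs_neg]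
    congr 1
    linarith
  have h5 : w j * (δ * ‖m‖) ≤ |⟪u, ω i⟫| * (w i + w j) := by
    have := mul_le_mul_of_nonneg_left hlt.le hwj
    linarith
  have h6 := mul_le_mul_of_nonneg_left h5 (hσ0 i hi)
  have h7 := mul_le_mul_of_nonneg_right hle (add_nonneg hwi hwj)
  refine le_of_mul_le_mul_right ?_ hm
  linarith

theorem weight_mul_le_of_dist_le {n d : ℕ} {W : Submodule ℝ (Euc d)}
    {I J : Finset (Fin n)} (hJI : J ⊆ I) (hJ : J.card + 1 = d) {ω : Fin n → Euc d}
    {w τ σ : Fin n → ℝ}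
    (hw0 : ∀ i ∈ J, 0 ≤ w i) (hwJ : ∀ i ∉ J, w i = 0) (hw1 : ∑ i, w i = 1)
    (hwW : ∑ i, w i • ω i ∈ W) (hτI : ∀ i ∉ I, τ i = 0) (hτ1 : ∑ i, τ i = 1)
    (hτW : ∑ i, τ i • ω i ∈ W) (hσ0 : ∀ i ∈ J, 0 ≤ σ i) (hσJ : ∀ i ∉ J, σ i = 0)
    (hσ1 : ∑ i, σ i = 1) {j : Fin n} (hj : j ∈ J) (hσj : σ j = 0) {ε δ : ℝ} (hε0 : 0 ≤ ε)
    (hε : dist (∑ i, τ i • ω i) (∑ i, σ i • ω i) ≤ ε)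
    (hflat : ∀ i ∈ J, i ≠ j → ω ∉ flatEvent W I J i j δ) :
    w j * δ ≤ ε * (1 + d * w j) := by
  have hsum := Finset.sum_le_sum fun i (hi : i ∈ J.erase j) =>
    weight_mul_le_of_notMem_flatEvent hJI hw0 hwJ hw1 hwW hτI hτ1 hτW hσ0 hσJ hσ1 hj hσj hε
      (Finset.mem_of_mem_erase hi) (Finset.ne_of_mem_erase hi)
      (hflat i (Finset.mem_of_mem_erase hi) (Finset.ne_of_mem_erase hi))
  have hσs : ∑ i ∈ J.erase j, σ i = 1 := by
    rw [← hσ1]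
    refine Finset.sum_subset (Finset.subset_univ _) fun i _ hi => ?_
    by_cases hij : i = j
    · rw [hij, hσj]
    · exact hσJ i fun h => hi (Finset.mem_erase.2 ⟨hij, h⟩)
  have hws : ∑ i ∈ J.erase j, w i ≤ 1 := by
    rw [← hw1]
    refine Finset.sum_le_sum_of_subset_of_nonneg (Finset.subset_univ _) fun i _ _ => ?_
    by_cases hi : i ∈ J
    · exact hw0 i hi
    · rw [hwJ i hi]
  have hcard : ((J.erase j).card : ℝ) ≤ d := by
    have := Finset.card_le_card (J.erase_subset j)
    exact_mod_cast this.trans (by omega)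
  rw [← Finset.sum_mul, hσs, one_mul, ← Finset.mul_sum, Finset.sum_add_distrib, Finset.sum_const,
    nsmul_eq_mul] at hsum
  refine hsum.trans (mul_le_mul_of_nonneg_left ?_ hε0)
  have := mul_le_mul_of_nonneg_right hcard (hw0 j hj)
  linarith

theorem IsGeneric.mem_flatEvent {n d : ℕ} {W : Submodule ℝ (Euc d)} {I J : Finset (Fin n)}
    (hJI : J ⊆ I) {ω : Fin n → Euc d} (hω : IsGeneric W I J ω) (hS : ω ∈ supportEvent W I J)
    {i j : Fin n} (hi : i ∈ J) (hj : j ∈ J) (hij : i ≠ j) {r : ℝ} (hr : dist (ω i) (ω j) ≤ r) :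
    ω ∈ flatEvent W I J i j r := by
  obtain ⟨-, -, w, -, -, hw0, hwJ, hw1, hwW⟩ := hS
  intro u m huW hu hum
  have hbal : w i * ⟪u, ω i⟫ + w j * ⟪u, ω j⟫ = 0 := by
    rw [← inner_sum_smul_eq_pair hij hu hwJ]
    exact Submodule.inner_left_of_mem_orthogonal hwW huW
  have hwi : 0 < w i := (hw0 i hi).lt_of_ne (hω.weight_ne_zero hwJ hw1 hwW hi).symm
  have hwj : 0 < w j := (hw0 j hj).lt_of_ne (hω.weight_ne_zero hwJ hw1 hwW hj).symm
  have habs : |⟪u, ω i⟫| + |⟪u, ω j⟫| = |⟪u, ω i⟫ - ⟪u, ω j⟫| := by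
    rw [sub_eq_add_neg, ← abs_neg ⟪u, ω j⟫]
    refine (abs_add_eq_add_abs_iff _ _).2 ?_ |>.symm
    rcases le_total 0 ⟪u, ω i⟫ with h | h
    · left
      refine ⟨h, ?_⟩
      have := mul_nonneg hwi.le h
      nlinarith
    · right
      refine ⟨h, ?_⟩
      have := mul_nonneg hwi.le (neg_nonneg.2 h)
      nlinarith
  have heq : ⟪u, ω i⟫ - ⟪u, ω j⟫ = ⟪m, ω i - ω j⟫ := by
    have := hum i (hJI hi) j (hJI hj)
    rw [inner_sub_left, inner_sub_right] at this
    linarith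
  rw [habs, heq, mul_comm]
  refine (abs_real_inner_le_norm _ _).trans ?_
  rw [← dist_eq_norm]
  gcongr

theorem exp_two_le : Real.exp 2 ≤ 7.3892 := by
  have h : Real.exp 2 = Real.exp 1 * Real.exp 1 := by rw [← Real.exp_add]; norm_num
  have h1 := Real.exp_one_lt_d9.le
  rw [h]
  exact (mul_le_mul h1 h1 (Real.exp_pos _).le (by norm_num)).trans (by norm_num)

/-- The configurations for which the line cut out by `W` on the affine span of the facet `I` comes
within `ε` of the relative boundary of the ridge `J`. -/
def nearEvent {n d : ℕ} (W : Submodule ℝ (Euc d)) (I J : Finset (Fin n)) (ε : ℝ) :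
    Set (Fin n → Euc d) :=
  {ω | ∃ x ∈ ↑W ∩ (affineSpan ℝ (ω '' ↑I) : Set (Euc d)),
    ∃ z ∈ intrinsicFrontier ℝ (convexHull ℝ (ω '' ↑J)), dist x z ≤ ε}

theorem measurableSet_forall_dist_le {n d : ℕ} (r : ℝ) :
    MeasurableSet {ω : Fin n → Euc d | ∀ i j, dist (ω i) (ω j) ≤ r} := by
  simp only [Set.ofPred_forall]
  refine MeasurableSet.iInter fun i => MeasurableSet.iInter fun j =>
    (isClosed_le ?_ continuous_const).measurableSet
  fun_prop

theorem exists_measurableSet_isGeneric {n d : ℕ} {W : Submodule ℝ (Euc d)}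
    (hW : Module.finrank ℝ W = 2) {I J : Finset (Fin n)} (hI : I.card = d)
    (hJ : J.card + 1 = d) (f : Fin n → Euc d → ℝ) :
    ∃ G : Set (Fin n → Euc d), MeasurableSet G ∧ productDensityMeasure f Gᶜ = 0 ∧
      ∀ ω ∈ G, IsGeneric W I J ω := by
  obtain ⟨N, hN, hNm, hN0⟩ := exists_measurable_superset_of_null
    (ae_iff.1 (ae_isGeneric (n := n) hW hI hJ))
  refine ⟨Nᶜ, hNm.compl, ?_, fun ω hω => ?_⟩
  · rw [compl_compl]
    exact withDensity_absolutelyContinuous _ _ hN0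
  · by_contra h
    exact hω (hN h)

theorem measure_flatEvent_le {n d : ℕ} {L : ℝ} (hL : 0 < L) {W : Submodule ℝ (Euc d)}
    (hW : Module.finrank ℝ W = 2) {f : Fin n → Euc d → ℝ} (hf : ∀ i, IsLogLipschitz L (f i))
    {I J : Finset (Fin n)} (hI : I.card = d) (hJI : J ⊆ I) (hJ : J.card + 1 = d)
    {i j : Fin n} (hi : i ∈ J) (hj : j ∈ J) (hij : i ≠ j) {s δ : ℝ} (hs : 1 ≤ s) (hδ : 0 < δ)
    {B : Set (Fin n → Euc d)} (hB : MeasurableSet B) (hBS : B ⊆ supportEvent W I J)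
    (hBf : B ⊆ flatEvent W I J i j δ) (hBg : ∀ ω ∈ B, IsGeneric W I J ω) :
    productDensityMeasure f B ≤
      ENNReal.ofReal (9 / 4 / s ^ 2 * Real.exp (L * (2 * s * δ))) *
        productDensityMeasure f (supportEvent W I J) := by
  obtain ⟨k, hk, rfl⟩ : ∃ k, k ∉ J ∧ insert k J = I := by
    have hne : (I \ J).Nonempty := by
      rw [← Finset.card_pos, Finset.card_sdiff_of_subset hJI]
      omega
    obtain ⟨k, hk⟩ := hne
    rw [Finset.mem_sdiff] at hk
    exact ⟨k, hk.2, Finset.eq_of_subset_of_card_le (Finset.insert_subset hk.1 hJI)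
      (by rw [Finset.card_insert_of_notMem hk.2]; omega)⟩
  have hS := measurableSet_supportEvent W (insert k J) J
  rw [productDensityMeasure_apply f hB, productDensityMeasure_apply f hS,
    ENNReal.ofReal_mul (by positivity)]
  exact lintegral_flatEvent_le hL hW hf hk hJ hi hj hij hs hδ hS hB hBS hBf
    fun ω hω c ψ hψ h1 h2 => (hBg ω hω).exists_smul_eq hk hJ hψ h1 h2

theorem measure_support_near_le_of_lt {n d : ℕ} {L : ℝ} (hL : 0 < L) (hL' : L < 1 / 39)
    {W : Submodule ℝ (Euc d)} (hW : Module.finrank ℝ W = 2)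
    {f : Fin n → Euc d → ℝ} (hf : ∀ i, IsLogLipschitz L (f i))
    {I J : Finset (Fin n)} (hI : I.card = d) (hJI : J ⊆ I) (hJ : J.card + 1 = d) (ε : ℝ) :
    productDensityMeasure f (supportEvent W I J ∩
      {ω | ∀ i j, dist (ω i) (ω j) ≤ 3} ∩ nearEvent W I J ε) ≤
        1 / 10 * productDensityMeasure f (supportEvent W I J) := by
  obtain ⟨G, hGm, hG0, hG⟩ := exists_measurableSet_isGeneric (n := n) hW hI hJ f
  have hS := measurableSet_supportEvent W I J
  by_cases hpair : ∃ i ∈ J, ∃ j ∈ J, i ≠ j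
  · obtain ⟨i, hi, j, hj, hij⟩ := hpair
    set B := supportEvent W I J ∩ {ω | ∀ i j, dist (ω i) (ω j) ≤ 3} ∩ G with hBdef
    have hBm : MeasurableSet B := (hS.inter (measurableSet_forall_dist_le 3)).inter hGm
    have hB := measure_flatEvent_le hL hW hf hI hJI hJ hi hj hij (s := 1 / (3 * L)) (δ := 3)
      (by rw [le_div_iff₀ (by positivity)]; linarith) (by norm_num) hBm (fun ω hω => hω.1.1)
      (fun ω hω => (hG ω hω.2).mem_flatEvent hJI hω.1.1 hi hj hij (hω.1.2 i j))
      fun ω hω => hG ω hω.2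
    have hsub : supportEvent W I J ∩ {ω | ∀ i j, dist (ω i) (ω j) ≤ 3} ∩ nearEvent W I J ε ⊆
        B ∪ Gᶜ := fun ω hω => by
      by_cases h : ω ∈ G
      · exact Or.inl ⟨hω.1, h⟩
      · exact Or.inr h
    refine (measure_mono hsub).trans ((measure_union_le _ _).trans ?_)
    rw [hG0, add_zero]
    refine hB.trans (mul_le_mul_left ?_ _)
    have h1 : L * (2 * (1 / (3 * L)) * 3) = 2 := by field_simp
    rw [h1]
    refine ENNReal.ofReal_le_of_le_toReal ?_
    have h2 : 9 / 4 / (1 / (3 * L)) ^ 2 = 81 / 4 * L ^ 2 := by field_simp; ring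
    have h3 : L ^ 2 ≤ (1 / 39) ^ 2 := by gcongr
    rw [h2]
    calc 81 / 4 * L ^ 2 * Real.exp 2 ≤ 81 / 4 * (1 / 39) ^ 2 * 7.3892 := by
          gcongr; exact exp_two_le
      _ ≤ 1 / 10 := by norm_num
      _ = _ := by simp
  · push Not at hpair
    have hsub : supportEvent W I J ∩ {ω | ∀ i j, dist (ω i) (ω j) ≤ 3} ∩ nearEvent W I J ε ⊆
        Gᶜ := fun ω hω hωG => by
      obtain ⟨-, x, -, z, hz, -⟩ := hω
      obtain ⟨j, hj, σ, -, h2, h3, h4, -⟩ :=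
        (hG ω hωG).exists_of_mem_intrinsicFrontier hI hJI hz
      have : ∀ i, σ i = 0 := fun i => by
        by_cases hi : i ∈ J
        · rw [hpair i hi j hj, h3]
        · exact h2 i hi
      simp [this] at h4
    rw [measure_mono_null hsub hG0]
    exact zero_le

theorem weight_le_of_mul_le {L w d : ℝ} (hL : 1 / 39 ≤ L) (hd : 2 ≤ d)
    (h : w * (1 / (18 * d * L)) ≤ 1 / (19200 * d ^ 4 * L ^ 2) * (1 + d * w)) :
    w ≤ 1 / (1014 * L * d ^ 3) := by
  have hL0 : 0 < L := lt_of_lt_of_le (by norm_num) hL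
  have hd0 : 0 < d := by linarith
  have hy : 1 / (d ^ 2 * L) ≤ 39 / 4 := by
    rw [div_le_div_iff₀ (by positivity) (by norm_num)]
    nlinarith
  have hfac : 1 / (1014 * L * d ^ 3) * (1 / (18 * d * L) - 1 / (19200 * d ^ 4 * L ^ 2) * d) -
      1 / (19200 * d ^ 4 * L ^ 2) = 1 / (d ^ 4 * L ^ 2) *
        (1 / 1014 * (1 / 18 - 1 / (d ^ 2 * L) / 19200) - 1 / 19200) := by
    field_simp
  have hpos : 0 < 1 / (18 * d * L) - 1 / (19200 * d ^ 4 * L ^ 2) * d := by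
    have : 1 / (18 * d * L) - 1 / (19200 * d ^ 4 * L ^ 2) * d =
        1 / (d * L) * (1 / 18 - 1 / (d ^ 2 * L) / 19200) := by field_simp
    rw [this]
    refine mul_pos (by positivity) ?_
    linarith
  have hnn : 0 ≤ 1 / (d ^ 4 * L ^ 2) *
      (1 / 1014 * (1 / 18 - 1 / (d ^ 2 * L) / 19200) - 1 / 19200) := by
    refine mul_nonneg (by positivity) ?_
    linarith
  refine le_of_mul_le_mul_right ?_ hpos
  linarith

theorem mem_flatEvent_or_mem_weightEvent {n d : ℕ} {L : ℝ} (hL : 1 / 39 ≤ L) (hd : 2 ≤ d)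
    {W : Submodule ℝ (Euc d)} {I J : Finset (Fin n)} (hI : I.card = d) (hJI : J ⊆ I)
    (hJ : J.card + 1 = d) {ω : Fin n → Euc d} (hω : IsGeneric W I J ω)
    (hS : ω ∈ supportEvent W I J)
    (hnear : ω ∈ nearEvent W I J (1 / (19200 * (d : ℝ) ^ 4 * L ^ 2))) :
    ∃ p ∈ J.offDiag, ω ∈ flatEvent W I J p.1 p.2 (1 / (18 * d * L)) ∨
      ω ∈ weightEvent W I J {w | w p.1 ≤ 1 / (1014 * L * d ^ 3) ∧ 1 / d ≤ w p.2} := by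
  have hL0 : 0 < L := lt_of_lt_of_le (by norm_num) hL
  have hd' : (2 : ℝ) ≤ d := by exact_mod_cast hd
  obtain ⟨c, h, w, hc, hlt, hw0, hwJ, hw1, hwW⟩ := hS
  obtain ⟨x, ⟨hxW, hx⟩, z, hz, hxz⟩ := hnear
  obtain ⟨τ, hτI, hτ1, rfl⟩ := exists_eq_sum_of_mem_affineSpan_image hx
  obtain ⟨j, hj, σ, hσ0, hσJ, hσj, hσ1, rfl⟩ := hω.exists_of_mem_intrinsicFrontier hI hJI hz
  by_cases hflat : ∃ i ∈ J, i ≠ j ∧ ω ∈ flatEvent W I J i j (1 / (18 * d * L))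
  · obtain ⟨i, hi, hij, hm⟩ := hflat
    exact ⟨(i, j), Finset.mem_offDiag.2 ⟨hi, hj, hij⟩, Or.inl hm⟩
  push Not at hflat
  have hwj := weight_le_of_mul_le hL hd' (weight_mul_le_of_dist_le hJI hJ hw0 hwJ hw1 hwW hτI hτ1
    hxW hσ0 hσJ hσ1 hj hσj (by positivity) hxz hflat)
  obtain ⟨k, hk, hwk⟩ : ∃ k ∈ J, 1 / (d : ℝ) ≤ w k := by
    refine Finset.exists_le_of_sum_le ⟨j, hj⟩ ?_
    rw [Finset.sum_subset (Finset.subset_univ J) fun i _ hi => hwJ i hi, hw1, Finset.sum_const,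
      nsmul_eq_mul, mul_one_div, div_le_one (by positivity)]
    exact_mod_cast (by omega)
  have hlt' : 1 / (1014 * L * (d : ℝ) ^ 3) < 1 / d := by
    refine one_div_lt_one_div_of_lt (by positivity) ?_
    have h1 : 26 ≤ 1014 * L := by linarith
    have h2 : (4 : ℝ) ≤ d ^ 2 := by nlinarith
    have h3 : (26 : ℝ) * 4 ≤ 1014 * L * d ^ 2 := mul_le_mul h1 h2 (by norm_num) (by positivity)
    have h4 := mul_le_mul_of_nonneg_right h3 (by linarith : (0 : ℝ) ≤ d)
    nlinarith
  refine ⟨(j, k), Finset.mem_offDiag.2 ⟨hj, hk, fun hjk => ?_⟩,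
    Or.inr ⟨c, h, w, hc, hlt, ⟨hw0, hwJ, hw1⟩, hwW, hwj, hwk⟩⟩
  have hjk' : j = k := hjk
  rw [← hjk'] at hwk
  linarith

theorem measure_support_near_le_of_le {n d : ℕ} {L : ℝ} (hL : 1 / 39 ≤ L) (hd : 2 ≤ d)
    {W : Submodule ℝ (Euc d)} (hW : Module.finrank ℝ W = 2)
    {f : Fin n → Euc d → ℝ} (hf : ∀ i, IsLogLipschitz L (f i))
    {I J : Finset (Fin n)} (hI : I.card = d) (hJI : J ⊆ I) (hJ : J.card + 1 = d) :
    productDensityMeasure f (supportEvent W I J ∩ {ω | ∀ i j, dist (ω i) (ω j) ≤ 3} ∩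
      nearEvent W I J (1 / (19200 * (d : ℝ) ^ 4 * L ^ 2))) ≤
        1 / 10 * productDensityMeasure f (supportEvent W I J) := by
  have hL0 : 0 < L := lt_of_lt_of_le (by norm_num) hL
  have hd' : (2 : ℝ) ≤ d := by exact_mod_cast hd
  have hd0 : (0 : ℝ) < d := by linarith
  obtain ⟨G, hGm, hG0, hG⟩ := exists_measurableSet_isGeneric (n := n) hW hI hJ f
  have hS := measurableSet_supportEvent W I J
  set ν := productDensityMeasure f with hν
  set δ : ℝ := 1 / (1014 * L * d ^ 3) with hδ
  set D := {ω : Fin n → Euc d | ∀ i j, dist (ω i) (ω j) ≤ 3} with hD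
  set A : Fin n × Fin n → Set (Fin n → Euc d) := fun p =>
    supportEvent W I J ∩ flatEvent W I J p.1 p.2 (1 / (18 * d * L)) ∩ G with hA
  set C : Fin n × Fin n → Set (Fin n → Euc d) := fun p =>
    weightEvent W I J {w | w p.1 ≤ δ ∧ 1 / d ≤ w p.2} ∩ D ∩ G with hC
  have hAle : ∀ p ∈ J.offDiag, ν (A p) ≤
      ENNReal.ofReal (0.0514 / d ^ 2) * ν (supportEvent W I J) := fun p hp => by
    obtain ⟨h1, h2, h12⟩ := Finset.mem_offDiag.1 hp
    have := measure_flatEvent_le hL0 hW hf hI hJI hJ h1 h2 h12 (s := 18 * d)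
      (δ := 1 / (18 * d * L)) (by linarith) (by positivity)
      ((hS.inter (measurableSet_flatEvent W I J _ _ _)).inter hGm) (fun ω hω => hω.1.1)
      (fun ω hω => hω.1.2) fun ω hω => hG ω hω.2
    refine this.trans (mul_le_mul_left (ENNReal.ofReal_le_ofReal ?_) _)
    have h3 : L * (2 * (18 * d) * (1 / (18 * d * L))) = 2 := by field_simp
    rw [h3]
    calc 9 / 4 / (18 * d : ℝ) ^ 2 * Real.exp 2 ≤ 9 / 4 / (18 * d : ℝ) ^ 2 * 7.3892 := by
          gcongr; exact exp_two_le
      _ = (9 / 4 / 324 * 7.3892 : ℝ) / d ^ 2 := by field_simp; norm_num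
      _ ≤ _ := by gcongr; norm_num
  have hCle : ∀ p ∈ J.offDiag, ν (C p) ≤
      ENNReal.ofReal (0.0417 / d ^ 2) * ν (supportEvent W I J) := fun p hp => by
    obtain ⟨h1, h2, h12⟩ := Finset.mem_offDiag.1 hp
    have hMδ : ((26 * d ^ 2 : ℕ) : ℝ) * δ = 1 / (39 * L) / d := by
      rw [hδ]; push_cast; field_simp; norm_num
    have hZ : IsClosed {w : Fin n → ℝ | w p.1 ≤ δ ∧ 1 / d ≤ w p.2} :=
      (isClosed_le (continuous_apply _) continuous_const).inter
        (isClosed_le continuous_const (continuous_apply _))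
    have := measure_smallWeight_le (M := 26 * d ^ 2) (δ := δ) hL0 hf hI hJI h1 h2 h12
      (by positivity)
      (by
        rw [hMδ]
        gcongr
        rw [div_le_one (by positivity)]
        linarith)
      (((measurableSet_weightEvent W I J hZ).inter (measurableSet_forall_dist_le 3)).inter hGm)
      (fun ω hω => hω.1.1) (fun ω hω => hG ω hω.2) fun ω hω => hω.1.2
    have h3 : L * (d * (3 * (((26 * d ^ 2 : ℕ) : ℝ) * δ))) = 1 / 13 := by
      rw [hMδ]; field_simp; norm_num
    have h4 : Real.exp (1 / 13) ≤ 13 / 12 := by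
      have h5 := Real.add_one_le_exp (-(1 / 13 : ℝ))
      rw [Real.exp_neg] at h5
      have h6 := Real.exp_pos (1 / 13 : ℝ)
      have h7 := mul_le_mul_of_nonneg_left h5 h6.le
      rw [mul_inv_cancel₀ h6.ne'] at h7
      linarith
    rw [h3] at this
    have hM0 : (0 : ℝ) < ((26 * d ^ 2 : ℕ) : ℝ) := by push_cast; positivity
    calc ν (C p) = ENNReal.ofReal (1 / ((26 * d ^ 2 : ℕ) : ℝ)) * ((26 * d ^ 2 : ℕ) * ν (C p)) := by
          rw [← mul_assoc, ← ENNReal.ofReal_natCast, ← ENNReal.ofReal_mul (by positivity),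
            one_div_mul_cancel hM0.ne', ENNReal.ofReal_one, one_mul]
      _ ≤ ENNReal.ofReal (1 / ((26 * d ^ 2 : ℕ) : ℝ)) *
            (ENNReal.ofReal (Real.exp (1 / 13)) * ν (supportEvent W I J)) :=
          mul_le_mul_right this _
      _ ≤ _ := by
          rw [← mul_assoc, ← ENNReal.ofReal_mul (by positivity)]
          refine mul_le_mul_left (ENNReal.ofReal_le_ofReal ?_) _
          calc 1 / ((26 * d ^ 2 : ℕ) : ℝ) * Real.exp (1 / 13)
              ≤ 1 / ((26 * d ^ 2 : ℕ) : ℝ) * (13 / 12) := by gcongr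
            _ = (13 / 12 / 26 : ℝ) / d ^ 2 := by push_cast; field_simp
            _ ≤ _ := by gcongr; norm_num
  have hsub : supportEvent W I J ∩ D ∩ nearEvent W I J (1 / (19200 * (d : ℝ) ^ 4 * L ^ 2)) ⊆
      (⋃ p ∈ J.offDiag, (A p ∪ C p)) ∪ Gᶜ := fun ω hω => by
    by_cases hωG : ω ∈ G
    swap
    · exact Or.inr hωG
    obtain ⟨p, hp, hor⟩ := mem_flatEvent_or_mem_weightEvent hL hd hI hJI hJ (hG ω hωG) hω.1.1 hω.2
    refine Or.inl (mem_iUnion₂.2 ⟨p, hp, ?_⟩)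
    exact hor.imp (fun h => ⟨⟨hω.1.1, h⟩, hωG⟩) fun h => ⟨⟨h, hω.1.2⟩, hωG⟩
  calc _ ≤ ν ((⋃ p ∈ J.offDiag, (A p ∪ C p)) ∪ Gᶜ) := measure_mono hsub
    _ ≤ ν (⋃ p ∈ J.offDiag, (A p ∪ C p)) := (measure_union_le _ _).trans (by rw [hG0, add_zero])
    _ ≤ ∑ p ∈ J.offDiag, ν (A p ∪ C p) := measure_biUnion_finset_le _ _
    _ ≤ ∑ p ∈ J.offDiag, ENNReal.ofReal (0.0931 / d ^ 2) * ν (supportEvent W I J) := by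
        refine Finset.sum_le_sum fun p hp => (measure_union_le _ _).trans ?_
        refine (add_le_add (hAle p hp) (hCle p hp)).trans ?_
        rw [← add_mul, ← ENNReal.ofReal_add (by positivity) (by positivity)]
        refine mul_le_mul_left (ENNReal.ofReal_le_ofReal ?_) _
        rw [← add_div]
        gcongr
        norm_num
    _ = ENNReal.ofReal (J.offDiag.card * (0.0931 / d ^ 2)) * ν (supportEvent W I J) := by
        rw [Finset.sum_const, nsmul_eq_mul, ENNReal.ofReal_mul (by positivity),
          ENNReal.ofReal_natCast, mul_assoc]
    _ ≤ 1 / 10 * ν (supportEvent W I J) := by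
        refine mul_le_mul_left (ENNReal.ofReal_le_of_le_toReal ?_) _
        have hcard : (J.offDiag.card : ℝ) ≤ d ^ 2 := by
          have h1 : J.offDiag.card ≤ d ^ 2 := by
            rw [Finset.offDiag_card]
            have : J.card ≤ d := by omega
            nlinarith [Nat.sub_le (J.card * J.card) J.card]
          exact_mod_cast h1
        calc (J.offDiag.card : ℝ) * (0.0931 / d ^ 2) ≤ d ^ 2 * (0.0931 / d ^ 2) := by gcongr
          _ = 0.0931 := by field_simp
          _ ≤ 1 / 10 := by norm_num
          _ = _ := by simp

theorem supportEvent_ae_eq {n d : ℕ} (hd : 2 ≤ d) {W : Submodule ℝ (Euc d)}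
    (hW : Module.finrank ℝ W = 2) (f : Fin n → Euc d → ℝ) {I J : Finset (Fin n)}
    (hI : I.card = d) (hJI : J ⊆ I) (hJ : J.card + 1 = d) (hIu : I ≠ Finset.univ) :
    (edgeEvent W I ∩ vertexEvent W J : Set (Fin n → Euc d)) =ᵐ[productDensityMeasure f]
      supportEvent W I J := by
  have hgen : ∀ᵐ ω ∂productDensityMeasure f, IsGeneric W I J ω :=
    (withDensity_absolutelyContinuous _ _).ae_le (ae_isGeneric hW hI hJ)
  refine Filter.eventuallyEq_set.2 (hgen.mono fun ω hω => ⟨hω.mem_supportEvent ?_,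
    hω.mem_edgeEvent_inter_vertexEvent hd hI hJI hJ hIu⟩)
  exact Finset.card_pos.1 (by omega)

/-- lower bound on the distance from the shadow-edge line to the ridge
boundary.  Let `a_1,…,a_n ∈ ℝ^d` be independent with `L`-log-Lipschitz densities and
`W ⊆ ℝ^d` a two-dimensional subspace.  Let `D` be the event that all pairwise distances
are at most `3`.  For every `I` of size `d` and every `J ⊆ I` of size `d - 1`,
`Pr[ dist(W ∩ affhull(a_i : i ∈ I), ∂conv(a_j : j ∈ J)) ≤ 1/(19200 d⁴ L²) | E_I ∧ A_J ]`
is at most `0.1 + Pr[¬D | E_I ∧ A_J]`. -/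
theorem stmt_8 (n d : ℕ) (L : ℝ) (hL : 0 < L)
    (W : Submodule ℝ (Euc d)) (hW : Module.finrank ℝ W = 2)
    (f : Fin n → Euc d → ℝ) (hf : ∀ i, IsLogLipschitz L (f i))
    (hnorm : ∀ i, ∫⁻ x, ENNReal.ofReal (f i x) = 1)
    (I : Finset (Fin n)) (hI : I.card = d)
    (J : Finset (Fin n)) (hJI : J ⊆ I) (hJ : J.card + 1 = d) :
    (productDensityMeasure f)[|edgeEvent W I ∩ vertexEvent W J]
        {ω | ∃ x ∈ ↑W ∩ (affineSpan ℝ (ω '' ↑I) : Set (Euc d)),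
          ∃ z ∈ intrinsicFrontier ℝ (convexHull ℝ (ω '' ↑J)),
            dist x z ≤ 1 / (19200 * (d : ℝ) ^ 4 * L ^ 2)}
      ≤ (1/10 : ℝ≥0∞) + (productDensityMeasure f)[|edgeEvent W I ∩ vertexEvent W J]
          {ω | ∀ i j, dist (ω i) (ω j) ≤ 3}ᶜ := by
  have hd : 2 ≤ d := by
    have := W.finrank_le
    rwa [hW, finrank_euclideanSpace_fin] at this
  by_cases hIu : I = Finset.univ
  · have hempty : edgeEvent W I = ∅ := by
      refine eq_empty_of_forall_notMem fun ω hω => hω.1.2.1 ?_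
      rw [hIu, Finset.coe_univ, image_univ]
    simp [hempty]
  set N := {ω : Fin n → Euc d | ∃ x ∈ ↑W ∩ (affineSpan ℝ (ω '' ↑I) : Set (Euc d)),
    ∃ z ∈ intrinsicFrontier ℝ (convexHull ℝ (ω '' ↑J)),
      dist x z ≤ 1 / (19200 * (d : ℝ) ^ 4 * L ^ 2)} with hN
  set D := {ω : Fin n → Euc d | ∀ i j, dist (ω i) (ω j) ≤ 3} with hD
  have hae := supportEvent_ae_eq hd hW f hI hJI hJ hIu
  have hS := measurableSet_supportEvent W I J
  set S := supportEvent W I J with hSdef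
  set ν := productDensityMeasure f
  have hmain : ν (S ∩ D ∩ N) ≤ 1 / 10 * ν S := by
    rcases lt_or_ge L (1 / 39) with h | h
    · exact measure_support_near_le_of_lt hL h hW hf hI hJI hJ _
    · exact measure_support_near_le_of_le h hd hW hf hI hJI hJ
  have hcond : ∀ A : Set (Fin n → Euc d), ν[|edgeEvent W I ∩ vertexEvent W J] A =
      (ν S)⁻¹ * ν (A ∩ S) := fun A => by
    rw [ProbabilityTheory.cond, measure_congr hae, Measure.restrict_congr_set hae,
      Measure.smul_apply, Measure.restrict_apply' hS, smul_eq_mul]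
  rw [hcond, hcond]
  have hsplit : N ∩ S ⊆ (S ∩ D ∩ N) ∪ (Dᶜ ∩ S) := fun ω ⟨h1, h2⟩ => by
    by_cases h : ω ∈ D
    · exact Or.inl ⟨⟨h2, h⟩, h1⟩
    · exact Or.inr ⟨h, h2⟩
  calc (ν S)⁻¹ * ν (N ∩ S) ≤ (ν S)⁻¹ * (1 / 10 * ν S + ν (Dᶜ ∩ S)) :=
        mul_le_mul_right ((measure_mono hsplit).trans ((measure_union_le _ _).trans
          (add_le_add hmain le_rfl))) _
    _ = 1 / 10 * ((ν S)⁻¹ * ν S) + (ν S)⁻¹ * ν (Dᶜ ∩ S) := by ring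
    _ ≤ 1 / 10 * 1 + (ν S)⁻¹ * ν (Dᶜ ∩ S) := by
        gcongr
        exact ENNReal.inv_mul_le_one _
    _ = _ := by rw [mul_one]
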